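/- arXiv:1511.01741 — 2 statements merged into one kernel-verified Lean document; each statement's English description precedes it below -/
import Mathlib

section
/- Let k be a field of characteristic zero and X a set with four elements. Then the Jacobson radical J(𝓡_X) of the 65536-dimensional monoid algebra 𝓡_X = k𝓒(X,X) of the monoid of relations on X has dimension 32616 as a k-vector space. -/
/-- Composition of correspondences: `rcomp R S = {(z,x) | ∃ y, (z,y) ∈ R ∧ (y,x) ∈ S}`. -/
def rcomp {α β γ : Type*} (R : Set (γ × β)) (S : Set (β × α)) : Set (γ × α) :=
  {p | ∃ y, (p.1, y) ∈ R ∧ (y, p.2) ∈ S}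

/-- The diagonal relation. -/
def diag (X : Type*) : Set (X × X) := {p | p.1 = p.2}

theorem rcomp_assoc {α β γ δ : Type*} (R : Set (δ × γ)) (S : Set (γ × β)) (T : Set (β × α)) :
    rcomp (rcomp R S) T = rcomp R (rcomp S T) := by
  ext ⟨z, x⟩
  constructor
  · rintro ⟨y, ⟨w, hw1, hw2⟩, hy⟩
    exact ⟨w, hw1, y, hw2, hy⟩
  · rintro ⟨w, hw, y, hy1, hy2⟩
    exact ⟨y, ⟨w, hw, hy1⟩, hy2⟩

theorem diag_rcomp {α β : Type*} (R : Set (β × α)) : rcomp (diag β) R = R := by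
  ext ⟨z, x⟩
  simp [rcomp, diag]

theorem rcomp_diag {α β : Type*} (R : Set (β × α)) : rcomp R (diag α) = R := by
  ext ⟨z, x⟩
  simp [rcomp, diag]

/-- The monoid `𝓒(X,X)` of all relations on `X` under composition of correspondences,
with identity the diagonal `Δ_X`. -/
instance relMonoid (X : Type*) : Monoid (Set (X × X)) where
  mul := rcomp
  one := diag X
  mul_assoc := rcomp_assoc
  one_mul := diag_rcomp
  mul_one := rcomp_diag

section LocalUnits

variable {M : Type*} [Monoid M]

/-- `g` is a unit of the local monoid `e M e`. -/
def IsLocalUnit (e g : M) : Prop :=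
  e * g = g ∧ g * e = g ∧ ∃ h, e * h = h ∧ h * e = h ∧ g * h = e ∧ h * g = e

theorem mul_eq_idem_comm [Finite M] {e p q : M} (hp : p * e = p) (hq : e * q = q)
    (he : e * e = e) (h : p * q = e) : q * p = e := by
  let φ : {x : M // e * x = x} → {x : M // e * x = x} :=
    fun x => ⟨q * x, by rw [← mul_assoc, hq]⟩
  have hφ : Function.Injective φ := fun x y hxy => by
    have h1 : q * (x : M) = q * y := congrArg Subtype.val hxy
    have h2 : p * (q * (x : M)) = p * (q * y) := by rw [h1]
    rw [← mul_assoc, ← mul_assoc, h, x.2, y.2] at h2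
    exact Subtype.ext h2
  obtain ⟨x, hx⟩ := Finite.injective_iff_surjective.1 hφ ⟨e, he⟩
  have hx1 : q * (x : M) = e := congrArg Subtype.val hx
  have : p = x :=
    calc p = p * (q * x) := by rw [hx1, hp]
      _ = x := by rw [← mul_assoc, h, x.2]
  rw [this, hx1]

theorem isLocalUnit_of_mul_eq [Finite M] {e p q : M} (he : e * e = e) (hp : e * p = p)
    (hpe : p * e = p) (hq : e * q = q) (hqe : q * e = q) (h : p * q = e) : IsLocalUnit e p :=
  ⟨hp, hpe, q, hq, hqe, h, mul_eq_idem_comm hpe hq he h⟩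

theorem isLocalUnit_self {e : M} (he : e * e = e) : IsLocalUnit e e :=
  ⟨he, he, e, he, he, he, he⟩

theorem exists_pow_idem [Finite M] (x : M) : ∃ n, n ≠ 0 ∧ x ^ n * x ^ n = x ^ n := by
  obtain ⟨a, b, hab, h⟩ := Finite.exists_ne_map_eq_of_infinite (fun n : ℕ => x ^ n)
  wlog hlt : a < b generalizing a b
  · exact this b a hab.symm h.symm (by omega)
  obtain ⟨d, rfl⟩ := Nat.exists_eq_add_of_lt hlt
  have hper : ∀ j c, a ≤ c → x ^ (c + j * (d + 1)) = x ^ c := by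
    intro j
    induction j with
    | zero => simp
    | succ j ih =>
      intro c hc
      obtain ⟨i, rfl⟩ := Nat.exists_eq_add_of_le hc
      rw [show a + i + (j + 1) * (d + 1) = (a + d + 1) + (i + j * (d + 1)) by ring, pow_add,
        ← show x ^ a = x ^ (a + d + 1) from h, ← pow_add, ← add_assoc]
      exact ih _ hc
  refine ⟨(a + 1) * (d + 1), by positivity, ?_⟩
  rw [← pow_add]
  exact hper (a + 1) _ (by nlinarith)

/-- A form of stability of finite monoids. -/
theorem exists_mul_mul_eq_self [Finite M] {x u v : M} (h : u * x * v = x) :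
    ∃ w, x * v * w = x := by
  have hpow : ∀ n : ℕ, u ^ n * x * v ^ n = x := by
    intro n
    induction n with
    | zero => simp
    | succ n ih =>
      calc u ^ (n + 1) * x * v ^ (n + 1) = u ^ n * (u * x * v) * v ^ n := by
            rw [pow_succ, pow_succ']; simp only [mul_assoc]
        _ = x := by rw [h, ih]
  obtain ⟨n, hn, hv⟩ := exists_pow_idem v
  have : x * v ^ n = x := by
    conv_lhs => rw [← hpow n]
    rw [mul_assoc, hv, hpow]
  refine ⟨v ^ (n - 1), ?_⟩
  rw [mul_assoc, mul_pow_sub_one hn, this]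

theorem exists_mul_mul_eq_self' [Finite M] {x u v : M} (h : u * x * v = x) :
    ∃ n, n ≠ 0 ∧ u ^ n * u ^ n = u ^ n ∧ u ^ n * x = x := by
  have hpow : ∀ n : ℕ, u ^ n * x * v ^ n = x := by
    intro n
    induction n with
    | zero => simp
    | succ n ih =>
      calc u ^ (n + 1) * x * v ^ (n + 1) = u ^ n * (u * x * v) * v ^ n := by
            rw [pow_succ, pow_succ']; simp only [mul_assoc]
        _ = x := by rw [h, ih]
  obtain ⟨n, hn, hu⟩ := exists_pow_idem u
  refine ⟨n, hn, hu, ?_⟩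
  conv_lhs => rw [← hpow n]
  rw [← mul_assoc, ← mul_assoc, hu, hpow]

end LocalUnits

namespace MonoidAlgebra

section LinExt

variable {k M W : Type*} [Field k] [AddCommGroup W] [Module k W]

/-- The `k`-linear extension to the monoid algebra of a function on the monoid. -/
noncomputable def linExt (t : M → W) : MonoidAlgebra k M →ₗ[k] W :=
  Finsupp.linearCombination k t ∘ₗ (coeffLinearEquiv k).toLinearMap

@[simp]
theorem linExt_single (t : M → W) (m : M) (c : k) : linExt t (single m c) = c • t m := by
  simp [linExt]

theorem linExt_eq_sum [Fintype M] (t : M → W) (a : MonoidAlgebra k M) :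
    linExt t a = ∑ m, a.coeff m • t m := by
  simp [linExt, Finsupp.linearCombination_apply, Finsupp.sum_fintype]

theorem linExt_linear (φ : MonoidAlgebra k M →ₗ[k] W) (a : MonoidAlgebra k M) :
    φ a = linExt (fun m => φ (single m 1)) a := by
  induction a using induction_linear with
  | zero => simp
  | add f g hf hg => simp [hf, hg]
  | single m c => rw [linExt_single, ← map_smul]; simp

theorem map_eq_zero_of_coeff [Fintype M] (φ : MonoidAlgebra k M →ₗ[k] W) (a : MonoidAlgebra k M)
    (h : ∀ m, a.coeff m ≠ 0 → φ (single m 1) = 0) : φ a = 0 := by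
  rw [linExt_linear, linExt_eq_sum]
  refine Finset.sum_eq_zero fun m _ => ?_
  by_cases hm : a.coeff m = 0
  · simp [hm]
  · simp [h m hm]

theorem linExt_mul_mul [Monoid M] (t : M → W) (u v : M) (a : MonoidAlgebra k M) :
    linExt t (single u 1 * a * single v 1) = linExt (fun m => t (u * m * v)) a := by
  induction a using induction_linear with
  | zero => simp
  | add f g hf hg => simp [mul_add, add_mul, hf, hg]
  | single m c => simp

theorem linExt_mul_mul_eq_zero [Monoid M] [Fintype M] {t : M → W} (b b' : MonoidAlgebra k M)
    {a : MonoidAlgebra k M}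
    (h : ∀ u v, b.coeff u ≠ 0 → b'.coeff v ≠ 0 → linExt (fun m => t (u * m * v)) a = 0) :
    linExt t (b * a * b') = 0 := by
  have h1 : ∀ u, b.coeff u ≠ 0 → linExt t (single u 1 * a * b') = 0 := fun u hu =>
    map_eq_zero_of_coeff (linExt t ∘ₗ LinearMap.mulLeft k (single u 1 * a)) b' fun v hv => by
      simp only [LinearMap.comp_apply, LinearMap.mulLeft_apply]
      rw [linExt_mul_mul, h u v hu hv]
  have h2 := map_eq_zero_of_coeff
    (linExt t ∘ₗ LinearMap.mulRight k b' ∘ₗ LinearMap.mulRight k a) b fun u hu => by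
      simpa using h1 u hu
  simpa using h2

instance finiteDimensional_of_finite [Finite M] : Module.Finite k (MonoidAlgebra k M) :=
  Module.Finite.equiv (coeffLinearEquiv k).symm

end LinExt

section Radical

variable {k M : Type*} [Field k] [Monoid M]

open Classical in
/-- The indicator function of the solutions `m` of `s * m * t = z`. -/
noncomputable def solInd (k : Type*) [Field k] (s t z m : M) : k :=
  if s * m * t = z then 1 else 0

theorem solInd_congr {s t z m s' t' z' m' : M} (h : s * m * t = z ↔ s' * m' * t' = z') :
    solInd k s t z m = solInd k s' t' z' m' := by
  classical
  exact if_congr h rfl rfl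

variable (k M) in
/-- The elements annihilated by all functionals `m ↦ [e u m v e = e]`, `e` idempotent. -/
noncomputable def idemNull : Submodule k (MonoidAlgebra k M) where
  carrier := {a | ∀ e u v : M, e * e = e → linExt (solInd k (e * u) (v * e) e) a = 0}
  add_mem' ha hb e u v he := by rw [map_add, ha e u v he, hb e u v he, add_zero]
  zero_mem' e u v he := map_zero _
  smul_mem' c a ha e u v he := by rw [map_smul, ha e u v he, smul_zero]

theorem mem_idemNull {a : MonoidAlgebra k M} : a ∈ idemNull k M ↔
    ∀ e u v : M, e * e = e → linExt (solInd k (e * u) (v * e) e) a = 0 := Iff.rfl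

theorem mul_mem_idemNull (b : MonoidAlgebra k M) {a : MonoidAlgebra k M}
    (ha : a ∈ idemNull k M) : b * a ∈ idemNull k M := by
  induction b using induction_linear with
  | zero => simp
  | add f g hf hg => rw [add_mul]; exact add_mem hf hg
  | single w c =>
    intro e u v he
    have h : single w c * a = c • (single w 1 * a * single 1 1) := by
      rw [← one_def, mul_one, ← smul_mul_assoc]; simp
    rw [h, map_smul, linExt_mul_mul, ← ha e (u * w) v he]
    have : (fun m => solInd k (e * u) (v * e) e (w * m * 1)) =
        solInd k (e * (u * w)) (v * e) e := by
      funext m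
      exact solInd_congr (by simp only [mul_assoc, one_mul])
    rw [this, ha e (u * w) v he, smul_zero]

theorem exists_idem_of_mul_mul_eq [Finite M] {s t z m₀ p p' r r' : M} (hm : s * m₀ * t = z)
    (hs : p * z * p' = s) (ht : r * z * r' = t) :
    ∃ e u v : M, e * e = e ∧ ∀ m, s * m * t = z ↔ e * u * m * (v * e) = e := by
  have h1 : (r * s * m₀) * t * r' = t := by
    conv_rhs => rw [← ht, ← hm]
    simp only [mul_assoc]
  obtain ⟨n, hn, he, het⟩ := exists_mul_mul_eq_self' h1
  set w := r * s * m₀ with hw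
  set e := w ^ n with hedef
  set y := e * w ^ (n - 1) * r with hy
  have hysm : y * s * m₀ = e := by
    rw [hy, mul_assoc, mul_assoc, mul_assoc, ← mul_assoc r, ← hw, pow_sub_one_mul hn]
    exact he
  have hyz : y * z = t := by
    rw [← hm, ← mul_assoc, ← mul_assoc, hysm, het]
  have hey : e * y = y := by rw [hy, ← mul_assoc, ← mul_assoc, he]
  have hst : p * s * (m₀ * t * p') = s := by
    conv_rhs => rw [← hs, ← hm]
    simp only [mul_assoc]
  obtain ⟨q, hq⟩ : ∃ q, t * q = e := by
    have h2 : (w ^ (n - 1) * (r * p * s * m₀)) * (t * (p' * m₀)) = e := by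
      have h4 : r * p * s * m₀ * (t * (p' * m₀)) = w := by
        conv_rhs => rw [hw, ← hst]
        simp only [mul_assoc]
      rw [mul_assoc, h4, pow_sub_one_mul hn]
    have h3 : (w ^ (n - 1) * (r * p * s * m₀)) * e * (t * (p' * m₀)) = e := by
      rw [mul_assoc _ e, ← mul_assoc e, het, h2]
    obtain ⟨x, hx⟩ := exists_mul_mul_eq_self h3
    refine ⟨p' * m₀ * x, ?_⟩
    rw [← mul_assoc e, het] at hx
    rw [← hx]
    simp only [mul_assoc]
  obtain ⟨ρ, hρ⟩ : ∃ ρ, z * ρ = s := by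
    obtain ⟨x, hx⟩ := exists_mul_mul_eq_self hst
    refine ⟨p' * x, ?_⟩
    rw [← hm]
    conv_rhs => rw [← hx]
    simp only [mul_assoc]
  refine ⟨e, y * s, 1, he, fun m => ?_⟩
  rw [one_mul, ← mul_assoc e, hey]
  constructor
  · intro h
    calc y * s * m * e = y * (s * m * t) * q := by rw [← hq]; simp only [mul_assoc]
      _ = e := by rw [h, hyz, hq]
  · intro h
    have h4 : y * s * m * t = t := by
      calc y * s * m * t = y * s * m * e * t := by rw [mul_assoc _ e, het]
        _ = t := by rw [h, het]
    calc s * m * t = s * m₀ * (e * t) * ρ * m * t := by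
          conv_lhs => rw [← hρ, ← hm]
          rw [het]
      _ = s * m₀ * (y * (z * ρ) * m * t) := by
          rw [het, ← hyz]; simp only [mul_assoc]
      _ = z := by rw [hρ, h4, hm]

/-- The two-sided divisibility relation `z ∈ M s M`. -/
def InIdealOf (z s : M) : Prop := ∃ u v : M, u * s * v = z

theorem InIdealOf.trans {x y z : M} (h : InIdealOf x y) (h' : InIdealOf y z) : InIdealOf x z := by
  obtain ⟨u, v, rfl⟩ := h
  obtain ⟨u', v', rfl⟩ := h'
  exact ⟨u * u', v' * v, by simp only [mul_assoc]⟩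

theorem linExt_solInd_eq_zero [Finite M] {a : MonoidAlgebra k M} (ha : a ∈ idemNull k M)
    {s t z : M} (hs : InIdealOf s z) (ht : InIdealOf t z) : linExt (solInd k s t z) a = 0 := by
  by_cases h : ∃ m₀, s * m₀ * t = z
  · obtain ⟨m₀, hm⟩ := h
    obtain ⟨p, p', hp⟩ := hs
    obtain ⟨r, r', hr⟩ := ht
    obtain ⟨e, u, v, he, h⟩ := exists_idem_of_mul_mul_eq hm hp hr
    rw [← ha e u v he]
    congr 2
    funext m
    exact solInd_congr (h m)
  · have : solInd k s t z = 0 := by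
      funext m
      simp only [solInd, Pi.zero_apply, ite_eq_right_iff, one_ne_zero]
      exact fun hm => h ⟨m, hm⟩
    rw [this]
    cases nonempty_fintype M
    simp [linExt_eq_sum]

theorem linExt_coeff (z : M) (a : MonoidAlgebra k M) [Fintype M] :
    linExt (solInd k 1 1 z) a = a.coeff z := by
  classical
  simp [linExt_eq_sum, solInd]

theorem isNilpotent_of_mem_idemNull [Finite M] {a : MonoidAlgebra k M} (ha : a ∈ idemNull k M) :
    IsNilpotent a := by
  cases nonempty_fintype M
  suffices H : ∀ n : ℕ, ∀ I : Set M, I.ncard ≤ n → (∀ m ∈ I, ∀ x, InIdealOf x m → x ∈ I) →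
      (∃ j : ℕ, ∀ m ∉ I, (a ^ j).coeff m = 0) → IsNilpotent a from
    H _ Set.univ le_rfl (fun _ _ _ _ => trivial) ⟨0, fun m hm => (hm trivial).elim⟩
  intro n
  induction n with
  | zero =>
    rintro I hI - ⟨j, hj⟩
    have hI' : I = ∅ := (Set.ncard_eq_zero (Set.toFinite I)).1 (Nat.le_zero.1 hI)
    refine ⟨j, ?_⟩
    ext m
    simp [hj m (by simp [hI'])]
  | succ n ih =>
    rintro I hI hideal ⟨j, hj⟩
    by_cases hne : I.Nonempty
    swap
    · exact ih I (by simp [Set.not_nonempty_iff_eq_empty.1 hne]) hideal ⟨j, hj⟩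
    obtain ⟨z, hz, hmax⟩ := Set.exists_max_image I (fun z => {x | InIdealOf x z}.ncard)
      (Set.toFinite I) hne
    have hcl : ∀ s ∈ I, InIdealOf z s → InIdealOf s z := by
      intro s hs hzs
      have hsub : {x | InIdealOf x z} ⊆ {x | InIdealOf x s} := fun x hx => hx.trans hzs
      have := Set.eq_of_subset_of_ncard_le hsub (hmax s hs) (Set.toFinite _)
      have hss : s ∈ {x | InIdealOf x s} := ⟨1, 1, by simp⟩
      rwa [← this] at hss
    refine ih (I \ {s | InIdealOf z s}) ?_ ?_ ⟨j + 1 + j, ?_⟩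
    · have hlt : (I \ {s | InIdealOf z s}).ncard < I.ncard := by
        refine Set.ncard_lt_ncard ⟨Set.sdiff_subset, fun h => ?_⟩ (Set.toFinite _)
        exact (h hz).2 ⟨1, 1, by simp⟩
      omega
    · rintro m ⟨hm, hm'⟩ x hx
      exact ⟨hideal m hm x hx, fun h => hm' (InIdealOf.trans h hx)⟩
    · intro x hx
      rw [pow_add, pow_add, pow_one, ← linExt_coeff]
      refine linExt_mul_mul_eq_zero _ _ fun s t hs ht => ?_
      have hsI : s ∈ I := by_contra fun h => hs (hj s h)
      have htI : t ∈ I := by_contra fun h => ht (hj t h)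
      have hfun : (fun m => solInd k 1 1 x (s * m * t)) = solInd k s t x :=
        funext fun m => solInd_congr (by simp)
      rw [hfun]
      by_cases hxI : ∃ m, s * m * t = x
      · obtain ⟨m, hm⟩ := hxI
        have hxs : InIdealOf x s := ⟨1, m * t, by rw [← hm]; simp [mul_assoc]⟩
        have hxt : InIdealOf x t := ⟨s * m, 1, by rw [← hm]; simp [mul_assoc]⟩
        have hzx : InIdealOf z x := by_contra fun h => hx ⟨hideal s hsI x hxs, h⟩
        exact linExt_solInd_eq_zero ha ((hcl s hsI (hzx.trans hxs)).trans hzx)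
          ((hcl t htI (hzx.trans hxt)).trans hzx)
      · have : solInd k s t x = 0 := by
          funext m
          simp only [solInd, Pi.zero_apply, ite_eq_right_iff, one_ne_zero]
          exact fun hm => hxI ⟨m, hm⟩
        simp [this, linExt_eq_sum]

theorem idemNull_le_jacobson [Finite M] {a : MonoidAlgebra k M} (ha : a ∈ idemNull k M) :
    a ∈ Ideal.jacobson (⊥ : Ideal (MonoidAlgebra k M)) := by
  rw [Ideal.mem_jacobson_iff]
  intro y
  obtain ⟨z, hz⟩ :=
    (isNilpotent_of_mem_idemNull (mul_mem_idemNull y ha)).isUnit_one_add.exists_left_inv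
  refine ⟨z, ?_⟩
  rw [Ideal.mem_bot, ← hz]
  noncomm_ring

theorem jacobson_le_idemNull [Finite M] [CharZero k] {a : MonoidAlgebra k M}
    (ha : a ∈ Ideal.jacobson (⊥ : Ideal (MonoidAlgebra k M))) : a ∈ idemNull k M := by
  classical
  cases nonempty_fintype M
  intro e u v he
  let Ω := {z : M // IsLocalUnit e z}
  let T : M → Matrix Ω Ω k := fun m => Matrix.of fun z z' => if e * m * e * z' = z then 1 else 0
  have hT : ∀ m m', T (m * e * m') = T m * T m' := by
    intro m m'
    ext z z'
    have hw2 : (z' : M) * e = z' := z'.2.2.1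
    obtain ⟨hz1, hz2, h, hh1, hh2, hh3, hh4⟩ := z.2
    simp only [T, Matrix.mul_apply, Matrix.of_apply, mul_ite, mul_one, mul_zero]
    by_cases hzz : e * (m * e * m') * e * (z' : M) = z
    · have hq1 : e * (e * m' * e * z') = e * m' * e * z' := by simp only [← mul_assoc, he]
      have hq2 : e * m' * e * z' * e = e * m' * e * z' := by rw [mul_assoc, hw2]
      have hpq : (h * (e * m * e)) * (e * m' * e * z') = e := by
        calc h * (e * m * e) * (e * m' * e * z') = h * (e * (m * e * m') * e * z') := by
              simp only [mul_assoc]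
              rw [← mul_assoc e e, he]
          _ = e := by rw [hzz, hh4]
      have hunit : IsLocalUnit e (e * m' * e * z') := by
        have hp1 : e * (h * (e * m * e)) = h * (e * m * e) := by rw [← mul_assoc, hh1]
        have hp2 : h * (e * m * e) * e = h * (e * m * e) := by simp only [mul_assoc, he]
        exact isLocalUnit_of_mul_eq he hq1 hq2 hp1 hp2
          (mul_eq_idem_comm hp2 hq1 he hpq)
      rw [if_pos hzz, Finset.sum_eq_single ⟨_, hunit⟩]
      · rw [if_pos rfl, if_pos]
        rw [← hzz]
        simp only [mul_assoc]
        rw [← mul_assoc e e, he]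
      · intro b _ hb
        rw [if_neg]
        exact fun h' => hb (Subtype.ext h'.symm)
      · simp
    · rw [if_neg hzz]
      symm
      refine Finset.sum_eq_zero fun x _ => ?_
      split_ifs with h1 h2
      · refine (hzz ?_).elim
        rw [← h2, ← h1]
        simp only [mul_assoc]
        rw [← mul_assoc e e, he]
      · rfl
      · rfl
  have hTl : ∀ b b' : MonoidAlgebra k M,
      linExt T (b * single e 1 * b') = linExt T b * linExt T b' := by
    intro b b'
    induction b using induction_linear with
    | zero => simp
    | add f g hf hg => simp only [add_mul, map_add, hf, hg]
    | single m c =>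
      induction b' using induction_linear with
      | zero => simp
      | add f g hf hg => simp only [mul_add, map_add, hf, hg]
      | single m' c' => simp [hT, smul_smul, mul_comm]
  set b := single (e * u) 1 * a * single (v * e) 1 with hb
  have hbe : b * single e 1 = b := by
    rw [hb, mul_assoc _ (single (v * e) 1), single_mul_single, mul_assoc v, he, mul_one]
  have hpow : ∀ n : ℕ, linExt T (b ^ (n + 1)) = linExt T b ^ (n + 1) := by
    intro n
    induction n with
    | zero => simp
    | succ n ih =>
      rw [pow_succ' b, ← hbe, hTl, hbe, ih, ← pow_succ']
  have hnil : IsNilpotent b := by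
    have : IsArtinianRing (MonoidAlgebra k M) := IsArtinianRing.of_finite k _
    have hJ := IsArtinianRing.isNilpotent_jacobson_bot (R := MonoidAlgebra k M)
    obtain ⟨n, hn⟩ := hJ
    have hbJ : b ∈ Ideal.jacobson (⊥ : Ideal (MonoidAlgebra k M)) :=
      Ideal.mul_mem_right _ _ (Ideal.mul_mem_left _ _ ha)
    refine ⟨n, ?_⟩
    have := Ideal.pow_mem_pow hbJ n
    rwa [hn] at this
  have hTnil : IsNilpotent (linExt T b) := by
    obtain ⟨n, hn⟩ := hnil
    refine ⟨n + 1, ?_⟩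
    rw [← hpow, pow_succ, hn, zero_mul, map_zero]
  have htr := (Matrix.isNilpotent_trace_of_isNilpotent hTnil).eq_zero
  have htrT : ∀ m, (T m).trace = (Fintype.card Ω : k) * solInd k e e e m := by
    intro m
    have : ∀ z : Ω, (if e * m * e * (z : M) = z then (1 : k) else 0) = solInd k e e e m := by
      intro z
      obtain ⟨hz1, hz2, h, hh1, hh2, hh3, hh4⟩ := z.2
      refine if_congr ?_ rfl rfl
      constructor
      · intro hz
        calc e * m * e = e * m * e * (z * h) := by rw [hh3, mul_assoc _ e e, he]
          _ = e := by rw [← mul_assoc, hz, hh3]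
      · intro hm
        rw [hm, hz1]
    simp [Matrix.trace, T, this]
  have hcomp : (linExt T b).trace = (Fintype.card Ω : k) * linExt (solInd k e e e) b := by
    rw [linExt_eq_sum, linExt_eq_sum, Matrix.trace_sum, Finset.mul_sum]
    refine Finset.sum_congr rfl fun m _ => ?_
    rw [Matrix.trace_smul, htrT, smul_eq_mul, smul_eq_mul]
    ring
  rw [hcomp] at htr
  have hcard : (Fintype.card Ω : k) ≠ 0 := by
    have : Nonempty Ω := ⟨⟨e, isLocalUnit_self he⟩⟩
    exact_mod_cast Fintype.card_ne_zero
  have h0 := (mul_eq_zero.1 htr).resolve_left hcard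
  rw [hb, linExt_mul_mul] at h0
  rw [← h0]
  congr 2
  funext m
  refine solInd_congr ?_
  have : e * (e * u * m * (v * e)) * e = e * u * m * (v * e) := by
    simp only [mul_assoc, he]
    rw [← mul_assoc e e, he]
  rw [this]

/-- The Jacobson radical of a finite monoid algebra in characteristic zero. -/
theorem jacobson_eq_idemNull [Finite M] [CharZero k] :
    Submodule.restrictScalars k (Ideal.jacobson (⊥ : Ideal (MonoidAlgebra k M))) =
      idemNull k M :=
  Submodule.ext fun _ => ⟨jacobson_le_idemNull, idemNull_le_jacobson⟩

end Radical

end MonoidAlgebra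

namespace MonoidAlgebra

variable {k M : Type*} [Field k] [Monoid M]

open Classical in
/-- Representatives of the left and right classes of an idempotent `e`: local units `u`, functionals
`u γ * y s` and vectors `x q`, separating each other through a nonsingular matrix. -/
structure IdemFrame (k : Type*) [Field k] {M : Type*} [Monoid M] (e : M) (S G : Type)
    [Fintype S] [Fintype G] where
  idem : e * e = e
  y : S → M
  u : G → M
  x : S × G → M
  idem_mul_y : ∀ s, e * y s = y s
  x_mul_idem : ∀ q, x q * e = x q
  isLocalUnit_u : ∀ γ, IsLocalUnit e (u γ)
  u_injective : Function.Injective u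
  exists_u : ∀ g, IsLocalUnit e g → ∃ γ, u γ = g
  exists_x : ∀ x', x' * e = x' → (∃ y', e * y' = y' ∧ y' * x' = e) →
    ∃ q, ∀ y', e * y' = y' → (y' * x' = e ↔ y' * x q = e)
  exists_y : ∀ y', e * y' = y' → (∃ x', x' * e = x' ∧ y' * x' = e) →
    ∃ s γ, ∀ x', x' * e = x' → (y' * x' = e ↔ u γ * y s * x' = e)
  det_ne_zero : Matrix.det (Matrix.of fun (j q : S × G) =>
    if u j.2 * y j.1 * x q = e then (1 : k) else 0) ≠ 0

namespace IdemFrame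

variable {e : M} {S G : Type} [Fintype S] [Fintype G]

theorem u_mul_eq_iff [Finite M] (F : IdemFrame k e S G) (γ : G) {z : M} (h1 : e * z = z)
    (h2 : z * e = z) : F.u γ * z = e ↔ z * F.u γ = e :=
  ⟨mul_eq_idem_comm (F.isLocalUnit_u γ).2.1 h1 F.idem,
    mul_eq_idem_comm h2 (F.isLocalUnit_u γ).1 F.idem⟩

theorem exists_solInd_eq [Finite M] (F : IdemFrame k e S G) {y' x' : M} (hy : e * y' = y')
    (hx : x' * e = x') : solInd k y' x' e = 0 ∨ ∃ s q, solInd k y' x' e =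
      solInd k (F.y s) (F.x q) e := by
  by_cases h : ∃ m, y' * m * x' = e
  · right
    obtain ⟨m₀, hm⟩ := h
    obtain ⟨s, γ, hsγ⟩ := F.exists_y y' hy ⟨m₀ * x', by rw [mul_assoc, hx], by rw [← mul_assoc, hm]⟩
    have key : ∀ m, y' * m * x' = e ↔ F.y s * m * (x' * F.u γ) = e := by
      intro m
      rw [mul_assoc, hsγ _ (by rw [mul_assoc, hx]), mul_assoc, F.u_mul_eq_iff]
      · simp only [mul_assoc]
      · rw [← mul_assoc, F.idem_mul_y]
      · simp only [mul_assoc, hx]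
    obtain ⟨q, hq⟩ := F.exists_x (x' * F.u γ) (by rw [mul_assoc, (F.isLocalUnit_u γ).2.1])
      ⟨F.y s * m₀, by rw [← mul_assoc, F.idem_mul_y], (key m₀).1 hm⟩
    refine ⟨s, q, funext fun m => solInd_congr ?_⟩
    rw [key, hq _ (by rw [← mul_assoc, F.idem_mul_y])]
  · left
    funext m
    simp only [solInd, Pi.zero_apply, ite_eq_right_iff, one_ne_zero]
    exact fun hm => h ⟨m, hm⟩

theorem eq_zero_of_solInd [Finite M] (F : IdemFrame k e S G) (c : S → S × G → k)
    (h : ∀ m m', ∑ s, ∑ q, c s q * solInd k (F.y s) (F.x q) e (m * e * m') = 0) : c = 0 := by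
  classical
  have hdet := F.det_ne_zero
  set C : Matrix (S × G) (S × G) k := Matrix.of fun (j q : S × G) =>
    if F.u j.2 * F.y j.1 * F.x q = e then (1 : k) else 0 with hC
  have hC' : ∀ j q, C j q = if F.u j.2 * F.y j.1 * F.x q = e then (1 : k) else 0 :=
    fun _ _ => rfl
  let μ : S × G → S × G → k := fun j' j =>
    ∑ q, c j.1 q * if F.u j'.2 * F.y j'.1 * F.x q = F.u j.2 then 1 else 0
  have hsol : ∀ (q' j' : S × G) (s : S) (q : S × G),
      solInd k (F.y s) (F.x q) e (F.x q' * (F.u j'.2 * F.y j'.1)) =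
      ∑ γ, (if F.u j'.2 * F.y j'.1 * F.x q = F.u γ then (1 : k) else 0) * C (s, γ) q' := by
    intro q' j' s q
    set Q := F.u j'.2 * F.y j'.1 * F.x q with hQ
    have hQ1 : e * Q = Q := by
      rw [hQ, ← mul_assoc, ← mul_assoc, (F.isLocalUnit_u _).1]
    have hQ2 : Q * e = Q := by rw [hQ, mul_assoc, F.x_mul_idem]
    have hP1 : e * (F.y s * F.x q') = F.y s * F.x q' := by rw [← mul_assoc, F.idem_mul_y]
    have hP2 : F.y s * F.x q' * e = F.y s * F.x q' := by rw [mul_assoc, F.x_mul_idem]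
    have hiff : F.y s * (F.x q' * (F.u j'.2 * F.y j'.1)) * F.x q = e ↔
        Q * (F.y s * F.x q') = e := by
      have : F.y s * (F.x q' * (F.u j'.2 * F.y j'.1)) * F.x q = F.y s * F.x q' * Q := by
        simp only [hQ, mul_assoc]
      rw [this]
      exact ⟨mul_eq_idem_comm hP2 hQ1 F.idem, mul_eq_idem_comm hQ2 hP1 F.idem⟩
    by_cases hunit : Q * (F.y s * F.x q') = e
    · obtain ⟨γ, hγ⟩ := F.exists_u Q (isLocalUnit_of_mul_eq F.idem hQ1 hQ2 hP1 hP2 hunit)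
      rw [Finset.sum_eq_single γ]
      · rw [solInd, if_pos (hiff.2 hunit), if_pos hγ.symm, hC', if_pos, one_mul]
        rw [hγ, mul_assoc, hunit]
      · intro γ' _ hne
        rw [if_neg, zero_mul]
        intro h'
        exact hne (F.u_injective (h'.symm.trans hγ.symm))
      · simp
    · rw [solInd, if_neg fun h' => hunit (hiff.1 h')]
      symm
      refine Finset.sum_eq_zero fun γ _ => ?_
      split_ifs with h1
      · rw [hC', if_neg, mul_zero]
        intro h'
        refine hunit ?_
        rw [h1, ← mul_assoc]
        exact h'
      · rw [zero_mul]
  have hμ : ∀ j', μ j' = 0 := by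
    intro j'
    refine Matrix.eq_zero_of_vecMul_eq_zero hdet ?_
    funext q'
    have h' := h (F.x q') (F.u j'.2 * F.y j'.1)
    rw [F.x_mul_idem] at h'
    simp only [hsol] at h'
    rw [Pi.zero_apply, ← h', Matrix.vecMul, dotProduct, Fintype.sum_prod_type]
    refine Finset.sum_congr rfl fun s _ => ?_
    simp only [μ, Finset.sum_mul, Finset.mul_sum]
    rw [Finset.sum_comm]
    refine Finset.sum_congr rfl fun q _ => Finset.sum_congr rfl fun γ _ => ?_
    rw [mul_assoc]
  obtain ⟨γ₀, hγ₀⟩ := F.exists_u e (isLocalUnit_self F.idem)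
  funext s
  refine Matrix.eq_zero_of_mulVec_eq_zero hdet ?_
  funext j'
  have := congrFun (hμ j') (s, γ₀)
  simp only [μ, hγ₀] at this
  refine Eq.trans ?_ this
  rw [Matrix.mulVec, dotProduct]
  exact Finset.sum_congr rfl fun q _ => mul_comm _ _

end IdemFrame

/-- The dimension of the Jacobson radical of a finite monoid algebra from a complete system of
framed idempotents. -/
theorem finrank_jacobson_add [Fintype M] [CharZero k] {ι : Type} [Fintype ι] (e : ι → M)
    (S G : ι → Type) [∀ i, Fintype (S i)] [∀ i, Fintype (G i)]
    (F : ∀ i, IdemFrame k (e i) (S i) (G i)) (c : ι → ℕ)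
    (hc : ∀ i i' u v, u * e i * v = e i' → i' = i ∨ c i' < c i)
    (he : ∀ e' : M, e' * e' = e' → ∃ i a b, a * b = e' ∧ b * a = e i) :
    Module.finrank k (Submodule.restrictScalars k
        (Ideal.jacobson (⊥ : Ideal (MonoidAlgebra k M)))) +
      ∑ i, Fintype.card (S i) * (Fintype.card (S i) * Fintype.card (G i)) = Fintype.card M := by
  classical
  rw [jacobson_eq_idemNull]
  let J := Σ i, S i × (S i × G i)
  let Φ : MonoidAlgebra k M →ₗ[k] (J → k) :=
    LinearMap.pi fun j => linExt (solInd k ((F j.1).y j.2.1) ((F j.1).x j.2.2) (e j.1))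
  have hΦ : ∀ a j, Φ a j =
      linExt (solInd k ((F j.1).y j.2.1) ((F j.1).x j.2.2) (e j.1)) a := fun _ _ => rfl
  have hker : LinearMap.ker Φ = idemNull k M := by
    ext a
    rw [LinearMap.mem_ker, mem_idemNull]
    constructor
    · intro ha e' u v he'
      obtain ⟨i, p, q, hpq, hqp⟩ := he e' he'
      have hsol : solInd k (e' * u) (v * e') e' = solInd k (e i * q * u) (v * p * e i) (e i) := by
        funext m
        refine solInd_congr ?_
        have h1 : e i * q = q * e' := by rw [← hqp, ← hpq, mul_assoc]
        have h2 : p * e i = e' * p := by rw [← hqp, ← hpq, mul_assoc]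
        constructor
        · intro h
          calc e i * q * u * m * (v * p * e i) = q * (e' * u * m * (v * e')) * p := by
                rw [mul_assoc v, h2, h1]; simp only [mul_assoc]
            _ = e i := by rw [h, ← h1, mul_assoc, hqp, (F i).idem]
        · intro h
          calc e' * u * m * (v * e') = p * (e i * q * u * m * (v * p * e i)) * q := by
                rw [mul_assoc v, h2, h1]
                calc e' * u * m * (v * e') = (e' * e') * u * m * (v * (e' * e')) := by rw [he']
                  _ = _ := by
                    conv_lhs => rw [← hpq]
                    rw [← hpq]
                    simp only [mul_assoc]
            _ = e' := by rw [h, h2, mul_assoc, hpq, he']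
      rw [hsol]
      rcases (F i).exists_solInd_eq (y' := e i * q * u) (x' := v * p * e i)
        (by rw [← mul_assoc, ← mul_assoc, (F i).idem]) (by rw [mul_assoc, (F i).idem]) with h | h
      · simp [h, linExt_eq_sum]
      · obtain ⟨s, t, h⟩ := h
        rw [h, ← hΦ a ⟨i, s, t⟩, ha, Pi.zero_apply]
    · intro ha
      funext j
      have := ha (e j.1) ((F j.1).y j.2.1) ((F j.1).x j.2.2) (F j.1).idem
      rwa [(F j.1).idem_mul_y, (F j.1).x_mul_idem] at this
  have hrange : LinearMap.range Φ = ⊤ := by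
    by_contra hne
    obtain ⟨f, hf, hle⟩ := Submodule.exists_le_ker_of_lt_top _ (lt_top_iff_ne_top.2 hne)
    have hsingle : ∀ v, f v = ∑ j, v j * f (Pi.single j 1) := by
      intro v
      rw [LinearMap.pi_apply_eq_sum_univ f]
      refine Finset.sum_congr rfl fun j _ => ?_
      rw [smul_eq_mul]
      congr 2
      funext j'
      rw [Pi.single_apply]
      simp only [eq_comm]
    let d : ∀ i, S i → S i × G i → k := fun i s q => f (Pi.single ⟨i, s, q⟩ 1)
    have hsum : ∀ m, ∑ i, ∑ s, ∑ q, d i s q *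
        solInd k ((F i).y s) ((F i).x q) (e i) m = 0 := by
      intro m
      have h0 : f (Φ (single m 1)) = 0 := hle ⟨_, rfl⟩
      rw [hsingle, Fintype.sum_sigma] at h0
      simp only [Fintype.sum_prod_type] at h0 ⊢
      rw [← h0]
      refine Finset.sum_congr rfl fun i _ => Finset.sum_congr rfl fun s _ =>
        Finset.sum_congr rfl fun q _ => Finset.sum_congr rfl fun γ _ => ?_
      rw [hΦ, linExt_single, one_smul, mul_comm]
    have hd : ∀ n i, c i = n → d i = 0 := by
      intro n
      induction n using Nat.strong_induction_on with
      | _ n ih =>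
        rintro i rfl
        refine (F i).eq_zero_of_solInd _ fun m m' => ?_
        rw [← hsum (m * e i * m')]
        symm
        refine Finset.sum_eq_single i (fun i' _ hi' => ?_) (by simp)
        refine Finset.sum_eq_zero fun s _ => Finset.sum_eq_zero fun q _ => ?_
        by_cases h : (F i').y s * (m * e i * m') * (F i').x q = e i'
        · have hlt := (hc i i' ((F i').y s * m) (m' * (F i').x q)
            (Eq.trans (by simp only [mul_assoc]) h)).resolve_left hi'
          simp [ih _ hlt i' rfl]
        · rw [solInd, if_neg h, mul_zero]
    refine hf (LinearMap.ext fun v => ?_)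
    rw [hsingle, LinearMap.zero_apply]
    refine Finset.sum_eq_zero fun j _ => ?_
    have : f (Pi.single j 1) = 0 := congrFun (congrFun (hd _ j.1 rfl) j.2.1) j.2.2
    rw [this, mul_zero]
  have hrn := LinearMap.finrank_range_add_finrank_ker Φ
  rw [hrange, hker, finrank_top, Module.finrank_fintype_fun_eq_card,
    (coeffLinearEquiv k).finrank_eq, Module.finrank_finsupp_self] at hrn
  rw [← hrn, add_comm]
  simp [J]

end MonoidAlgebra
namespace RelCode

/-- The relation on `Fin 4` whose characteristic bits are the binary digits of `c`. -/
def dec (c : ℕ) : Set (Fin 4 × Fin 4) := {p | c.testBit (4 * (p.1 : ℕ) + p.2)}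

/-- The code of the composite of two relations. -/
def mulN (a b : ℕ) : ℕ :=
  (a &&& 4369) * (b &&& 15) ||| ((a >>> 1) &&& 4369) * ((b >>> 4) &&& 15) |||
    ((a >>> 2) &&& 4369) * ((b >>> 8) &&& 15) ||| ((a >>> 3) &&& 4369) * ((b >>> 12) &&& 15)

/-- The code of the converse relation. -/
def trN (c : ℕ) : ℕ := Nat.ofBits (n := 16) fun k => c.testBit (4 * (k % 4 : ℕ) + k / 4)

theorem mem_dec {c : ℕ} {i j : Fin 4} : (i, j) ∈ dec c ↔ c.testBit (4 * (i : ℕ) + j) := Iff.rfl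

theorem mem_mul {R S : Set (Fin 4 × Fin 4)} {i j : Fin 4} :
    (i, j) ∈ R * S ↔ ∃ l, (i, l) ∈ R ∧ (l, j) ∈ S := Iff.rfl

theorem testBit_and_mul (n r : ℕ) (hr : r < 16) (i j : Fin 4) :
    ((n &&& 4369) * r).testBit (4 * (i : ℕ) + j) = (n.testBit (4 * (i : ℕ)) && r.testBit j) := by
  have h : n &&& 4369 = (n.testBit 0).toNat * 2 ^ 0 ||| (n.testBit 4).toNat * 2 ^ 4 |||
      (n.testBit 8).toNat * 2 ^ 8 ||| (n.testBit 12).toNat * 2 ^ 12 := by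
    rw [show 4369 = 2 ^ 0 ||| 2 ^ 4 ||| 2 ^ 8 ||| 2 ^ 12 from rfl, Nat.and_or_distrib_left,
      Nat.and_or_distrib_left, Nat.and_or_distrib_left]
    simp only [Nat.and_two_pow]
  have key : ∀ b0 b1 b2 b3 : Bool, ∀ r : Fin 16, ∀ i j : Fin 4,
      ((b0.toNat * 2 ^ 0 ||| b1.toNat * 2 ^ 4 ||| b2.toNat * 2 ^ 8 ||| b3.toNat * 2 ^ 12) *
        (r : ℕ)).testBit (4 * (i : ℕ) + j) = (![b0, b1, b2, b3] i && (r : ℕ).testBit j) := by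
    decide +kernel
  rw [h, key _ _ _ _ ⟨r, hr⟩ i j]
  congr 1
  fin_cases i <;> rfl

theorem and_fifteen_lt (n : ℕ) : n &&& 15 < 16 := Nat.and_lt_two_pow n (n := 4) (by norm_num)

theorem testBit_row (n i : ℕ) (j : Fin 4) :
    ((n >>> (4 * i)) &&& 15).testBit j = n.testBit (4 * i + j) := by
  rw [Nat.testBit_and, Nat.testBit_shiftRight]
  have : (15 : ℕ).testBit j = true := by fin_cases j <;> rfl
  rw [this, Bool.and_true]

theorem dec_mulN (a b : ℕ) : dec (mulN a b) = dec a * dec b := by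
  ext ⟨i, j⟩
  rw [mem_mul, mem_dec, mulN, Nat.testBit_or, Nat.testBit_or, Nat.testBit_or]
  have h0 := testBit_and_mul a _ (and_fifteen_lt (b >>> (4 * 0))) i j
  have h1 := testBit_and_mul (a >>> 1) _ (and_fifteen_lt (b >>> (4 * 1))) i j
  have h2 := testBit_and_mul (a >>> 2) _ (and_fifteen_lt (b >>> (4 * 2))) i j
  have h3 := testBit_and_mul (a >>> 3) _ (and_fifteen_lt (b >>> (4 * 3))) i j
  rw [testBit_row] at h0 h1 h2 h3
  simp only [Nat.testBit_shiftRight] at h1 h2 h3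
  simp only [mul_zero, Nat.shiftRight_zero, mul_one, Nat.reduceMul] at h0 h1 h2 h3
  rw [h0, h1, h2, h3]
  simp only [Fin.exists_fin_succ, mem_dec]
  simp [add_comm, or_assoc]

theorem mulN_lt (a b : ℕ) : mulN a b < 65536 := by
  have h : ∀ m n : ℕ, (m &&& 4369) * (n &&& 15) < 2 ^ 16 := fun m n => by
    have h1 : m &&& 4369 ≤ 4369 := Nat.and_le_right
    have h2 : n &&& 15 ≤ 15 := Nat.and_le_right
    exact lt_of_le_of_lt (Nat.mul_le_mul h1 h2) (by norm_num)
  exact Nat.or_lt_two_pow (Nat.or_lt_two_pow (Nat.or_lt_two_pow (h _ _) (h _ _)) (h _ _)) (h _ _)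

theorem dec_injOn {a b : ℕ} (ha : a < 65536) (hb : b < 65536) (h : dec a = dec b) : a = b := by
  refine Nat.eq_of_testBit_eq fun i => ?_
  by_cases hi : i < 16
  · have h1 : (((⟨i / 4, by omega⟩, ⟨i % 4, by omega⟩) : Fin 4 × Fin 4) ∈ dec a ↔
        ((⟨i / 4, by omega⟩, ⟨i % 4, by omega⟩) : Fin 4 × Fin 4) ∈ dec b) := by rw [h]
    simp only [mem_dec, Nat.div_add_mod] at h1
    exact Bool.eq_iff_iff.2 h1
  · have hp : 65536 ≤ 2 ^ i :=
      le_trans (by norm_num) (Nat.pow_le_pow_right (n := 2) (by norm_num) (not_lt.1 hi))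
    rw [Nat.testBit_lt_two_pow (ha.trans_le hp), Nat.testBit_lt_two_pow (hb.trans_le hp)]

theorem exists_dec (R : Set (Fin 4 × Fin 4)) : ∃ c < 65536, dec c = R := by
  have hinj : Function.Injective fun c : Fin 65536 => dec c :=
    fun a b h => Fin.ext (dec_injOn a.2 b.2 h)
  have hbij := (Fintype.bijective_iff_injective_and_card _).2 ⟨hinj, by simp⟩
  obtain ⟨c, hc⟩ := hbij.2 R
  exact ⟨c, c.2, hc⟩

theorem dec_trN {c : ℕ} {i j : Fin 4} : (i, j) ∈ dec (trN c) ↔ (j, i) ∈ dec c := by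
  have h : 4 * (i : ℕ) + j < 16 := by omega
  rw [mem_dec, mem_dec, trN, Nat.testBit_ofBits_lt _ _ h]
  have h1 : (4 * (i : ℕ) + j) % 4 = j := by omega
  have h2 : (4 * (i : ℕ) + j) / 4 = i := by omega
  simp only [h1, h2]

/-- Row vectors, encoded by numbers below `16`, are determined by their bits. -/
theorem mask_ext {s t : ℕ} (hs : s < 16) (ht : t < 16)
    (h : ∀ b : Fin 4, s.testBit b = t.testBit b) : s = t := by
  refine Nat.eq_of_testBit_eq fun i => ?_
  by_cases hi : i < 4
  · exact h ⟨i, hi⟩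
  · have hp : 16 ≤ 2 ^ i :=
      le_trans (by norm_num) (Nat.pow_le_pow_right (n := 2) (by norm_num) (not_lt.1 hi))
    rw [Nat.testBit_lt_two_pow (hs.trans_le hp), Nat.testBit_lt_two_pow (ht.trans_le hp)]

theorem exists_mask (s : Set (Fin 4)) : ∃ t < 16, ∀ b : Fin 4, t.testBit b ↔ b ∈ s := by
  have hinj : Function.Injective fun (c : Fin 16) => {b : Fin 4 | (c : ℕ).testBit b} :=
    fun a b h => Fin.ext (mask_ext a.2 b.2 fun i => Bool.eq_iff_iff.2 (Set.ext_iff.1 h i))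
  have hbij := (Fintype.bijective_iff_injective_and_card _).2 ⟨hinj, by simp⟩
  obtain ⟨c, hc⟩ := hbij.2 s
  exact ⟨c, c.2, fun b => Set.ext_iff.1 hc b⟩

/-- The relation code with prescribed rows. -/
def ofRows (t₀ t₁ t₂ t₃ : ℕ) : ℕ := t₀ ||| t₁ <<< 4 ||| t₂ <<< 8 ||| t₃ <<< 12

theorem mem_dec_ofRows {t : Fin 4 → ℕ} (ht : ∀ z, t z < 16) {z b : Fin 4} :
    (z, b) ∈ dec (ofRows (t 0) (t 1) (t 2) (t 3)) ↔ (t z).testBit b := by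
  have hf : ∀ y i, 4 ≤ i → (t y).testBit i = false := fun y i hi =>
    Nat.testBit_lt_two_pow ((ht y).trans_le
      (le_trans (by norm_num) (Nat.pow_le_pow_right (n := 2) (by norm_num) hi)))
  rw [mem_dec, ofRows, Nat.testBit_or, Nat.testBit_or, Nat.testBit_or]
  simp only [Nat.testBit_shiftLeft]
  fin_cases z <;> fin_cases b <;> simp [hf]

end RelCode

namespace RelCode

/-- Row `a` of a relation code. -/
def row (e a : ℕ) : ℕ := (e >>> (4 * a)) &&& 15

/-- The row vector `t` is the top one or is contained in some row of `e`. -/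
def goodRow (e t : ℕ) : Bool :=
  Nat.beq t (mulN 15 e) || (List.range 4).any fun a => Nat.beq (t &&& row e a) t

/-- The admissible rows of normalized vectors for `e`. -/
def gRows (e : ℕ) : List ℕ :=
  (List.range 16).filter fun t => Nat.beq (mulN t e) t && goodRow e t

/-- The rows of `e` at its reflexive points. -/
def reflRows (e : ℕ) : List ℕ := ((List.range 4).filter fun a => e.testBit (5 * a)).map (row e)

/-- Evaluation of `f` at `n`, in a form whose kernel reduction evaluates `n` first. -/
def force (n : ℕ) (f : ℕ → Bool) : Bool :=
  match n with
  | 0 => f 0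
  | m + 1 => f (m + 1)

theorem force_eq (n : ℕ) (f : ℕ → Bool) : force n f = f n := by
  cases n <;> rfl

/-- Evaluation of `f` at `l`, in a form whose kernel reduction evaluates `l` first. -/
def forceList : List ℕ → (List ℕ → Bool) → Bool
  | [], f => f []
  | a :: l, f => force a fun a => forceList l fun l => f (a :: l)

theorem forceList_eq : ∀ (l : List ℕ) (f : List ℕ → Bool), forceList l f = f l
  | [], _ => rfl
  | a :: l, f => by rw [forceList, force_eq, forceList_eq l]

/-- The candidates in `G` for a row equal to all members of `R`. -/
def lastRows (G : List ℕ) : List ℕ → List ℕ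
  | [] => G
  | r :: _ => [r]

/-- The predicate `P` holds for all normalized vectors for `e`. -/
def allNormal (e : ℕ) (P : ℕ → Bool) : Bool :=
  forceList (reflRows e) fun R => forceList (gRows e) fun G =>
    G.all fun t₀ => G.all fun t₁ => G.all fun t₂ =>
      forceList (R.filter fun r => !(Nat.beq r t₀ || Nat.beq r t₁ || Nat.beq r t₂)) fun R' =>
        (lastRows G R').all fun t₃ =>
          !(R'.all fun r => Nat.beq r t₃) || force (ofRows t₀ t₁ t₂ t₃) P

theorem of_allNormal {e : ℕ} {P : ℕ → Bool} (h : allNormal e P = true) {t₀ t₁ t₂ t₃ : ℕ}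
    (h₀ : t₀ ∈ gRows e) (h₁ : t₁ ∈ gRows e) (h₂ : t₂ ∈ gRows e) (h₃ : t₃ ∈ gRows e)
    (hR : ∀ r ∈ reflRows e, r = t₀ ∨ r = t₁ ∨ r = t₂ ∨ r = t₃) :
    P (ofRows t₀ t₁ t₂ t₃) = true := by
  rw [allNormal, forceList_eq, forceList_eq] at h
  have h' := List.all_eq_true.1 (List.all_eq_true.1 (List.all_eq_true.1 h _ h₀) _ h₁) _ h₂
  rw [forceList_eq] at h'
  have hR' : ∀ r ∈ (reflRows e).filter
      fun r => !(Nat.beq r t₀ || Nat.beq r t₁ || Nat.beq r t₂), r = t₃ := by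
    intro r hr
    obtain ⟨hr, hne⟩ := List.mem_filter.1 hr
    simp only [Bool.not_or, Bool.and_eq_true, Bool.not_eq_true'] at hne
    have hb : ∀ t, Nat.beq r t = false → r ≠ t := fun t ht hrt => by
      rw [hrt, Nat.beq_refl] at ht
      exact Bool.noConfusion ht
    rcases hR r hr with h | h | h | h
    exacts [absurd h (hb _ hne.1.1), absurd h (hb _ hne.1.2), absurd h (hb _ hne.2), h]
  generalize (reflRows e).filter
    (fun r => !(Nat.beq r t₀ || Nat.beq r t₁ || Nat.beq r t₂)) = R at h' hR'
  have hlast : t₃ ∈ lastRows (gRows e) R := by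
    cases R with
    | nil => exact h₃
    | cons r R => rw [lastRows, hR' r List.mem_cons_self]; exact List.mem_singleton_self _
  have h4 := List.all_eq_true.1 h' _ hlast
  have hall : (R.all fun r => Nat.beq r t₃) = true :=
    List.all_eq_true.2 fun r hr => Nat.beq_eq.symm ▸ hR' r hr
  rw [hall, force_eq] at h4
  exact h4

theorem beq_of_eq {a b : ℕ} (h : a = b) : Nat.beq a b = true := h ▸ Nat.beq_refl a

theorem row_lt (e a : ℕ) : row e a < 16 := and_fifteen_lt _

theorem mem_dec_row {e : ℕ} {a b : Fin 4} : (a, b) ∈ dec e ↔ (row e a).testBit b := by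
  rw [row, testBit_row, mem_dec]

theorem and_eq_iff {s t : ℕ} (ht : t < 16) :
    t &&& s = t ↔ ∀ b : Fin 4, t.testBit b → s.testBit b := by
  constructor
  · intro h b hb
    rw [← h, Nat.testBit_and, Bool.and_eq_true] at hb
    exact hb.2
  · intro h
    refine mask_ext (lt_of_le_of_lt Nat.and_le_left ht) ht fun b => ?_
    rw [Nat.testBit_and]
    have := h b
    cases h1 : t.testBit b <;> simp_all

theorem mul_eq_of_rows {x x' E y : Set (Fin 4 × Fin 4)}
    (h : ∀ z, (∀ b, (z, b) ∈ x ↔ (z, b) ∈ x') ∨ ∀ a, ∃ b, (z, b) ∈ x ∧ (a, b) ∉ E)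
    (hy : y * x = E) : y * x' = E := by
  have hz : ∀ a z, (a, z) ∈ y → ∀ b, (z, b) ∈ x ↔ (z, b) ∈ x' := by
    intro a z haz
    refine (h z).resolve_right fun h' => ?_
    obtain ⟨b, hb, hb'⟩ := h' a
    exact hb' (hy ▸ mem_mul.2 ⟨z, haz, hb⟩)
  rw [← hy]
  ext ⟨a, b⟩
  rw [mem_mul, mem_mul]
  exact exists_congr fun z => and_congr_right fun haz => (hz a z haz b).symm

theorem mem_dec_of_lt {t : ℕ} (ht : t < 16) {a b : Fin 4} :
    (a, b) ∈ dec t ↔ a = 0 ∧ t.testBit b := by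
  have := mem_dec_ofRows (t := ![t, 0, 0, 0]) (z := a) (b := b) (by
    intro z; fin_cases z <;> simp [ht])
  simp only [ofRows] at this
  simp only [Matrix.cons_val_zero, Matrix.cons_val_one, Matrix.cons_val, Nat.zero_shiftLeft,
    Nat.or_zero] at this
  rw [this]
  fin_cases a <;> simp

theorem mulN_lt_of_lt {t : ℕ} (ht : t < 16) (e : ℕ) : mulN t e < 16 := by
  obtain ⟨s, hs, hst⟩ := exists_mask {b | (0, b) ∈ dec (mulN t e)}
  have : dec (mulN t e) = dec s := by
    ext ⟨a, b⟩
    rw [mem_dec_of_lt hs, hst, Set.mem_ofPred_eq, dec_mulN, mem_mul, mem_mul]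
    simp only [mem_dec_of_lt ht]
    constructor
    · rintro ⟨l, ⟨rfl, h⟩, h'⟩
      exact ⟨rfl, l, ⟨trivial, h⟩, h'⟩
    · rintro ⟨rfl, l, h, h'⟩
      exact ⟨l, ⟨rfl, h.2⟩, h'⟩
  rwa [dec_injOn (mulN_lt _ _) (hs.trans (by norm_num)) this]

theorem testBit_mulN {t : ℕ} (ht : t < 16) (e : ℕ) (b : Fin 4) :
    (mulN t e).testBit b ↔ ∃ l : Fin 4, t.testBit l ∧ (l, b) ∈ dec e := by
  have h := mem_dec_of_lt (mulN_lt_of_lt ht e) (a := 0) (b := b)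
  rw [dec_mulN, mem_mul] at h
  simpa [mem_dec_of_lt ht] using h.symm

theorem testBit_mulN_fifteen (e : ℕ) (b : Fin 4) :
    (mulN 15 e).testBit b ↔ ∃ l, (l, b) ∈ dec e := by
  rw [testBit_mulN (by norm_num)]
  refine exists_congr fun l => and_iff_right ?_
  fin_cases l <;> rfl

theorem goodRow_of_subset {e t : ℕ} (ht : t < 16) (a : Fin 4)
    (h : ∀ b : Fin 4, t.testBit b → (a, b) ∈ dec e) : goodRow e t = true := by
  rw [goodRow, Bool.or_eq_true, List.any_eq_true]
  refine Or.inr ⟨a, List.mem_range.2 a.2, beq_of_eq ?_⟩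
  exact (and_eq_iff ht).2 fun b hb => mem_dec_row.1 (h b hb)

/-- Every vector `x` with `x e = x` that can be completed to `e` has the same completions as some
normalized vector. -/
theorem exists_normal {e : ℕ} (he : mulN e e = e) {P : ℕ → Bool} (h : allNormal e P = true)
    {x : Set (Fin 4 × Fin 4)} (hx : x * dec e = x) (hy : ∃ y, y * x = dec e) :
    ∃ c, P c = true ∧ ∀ y, y * x = dec e ↔ y * dec c = dec e := by
  choose t ht htx using fun z => exists_mask {b | (z, b) ∈ x}
  simp only [Set.mem_ofPred_eq] at htx
  let t' : Fin 4 → ℕ := fun z => if goodRow e (t z) then t z else mulN 15 e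
  have htT : ∀ z, mulN (t z) e = t z := by
    intro z
    refine mask_ext (mulN_lt_of_lt (ht z) e) (ht z) fun b => Bool.eq_iff_iff.2 ?_
    rw [testBit_mulN (ht z), htx]
    conv_rhs => rw [← hx, mem_mul]
    simp only [htx]
  have htopT : mulN (mulN 15 e) e = mulN 15 e := by
    refine dec_injOn (mulN_lt _ _) (mulN_lt _ _) ?_
    rw [dec_mulN, dec_mulN, mul_assoc, ← dec_mulN, he]
  have ht' : ∀ z, t' z < 16 := by
    intro z
    simp only [t']
    split_ifs
    exacts [ht z, mulN_lt_of_lt (by norm_num) e]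
  have hmem : ∀ z, t' z ∈ gRows e := by
    intro z
    rw [gRows, List.mem_filter, List.mem_range, Bool.and_eq_true]
    refine ⟨ht' z, ?_⟩
    simp only [t']
    split_ifs with hg
    · exact ⟨beq_of_eq (htT z), hg⟩
    · exact ⟨beq_of_eq htopT, by simp [goodRow]⟩
  have hsub : ∀ z (b : Fin 4), (t z).testBit b → (mulN 15 e).testBit b := by
    intro z b hb
    rw [← htT z, testBit_mulN (ht z)] at hb
    obtain ⟨l, -, hl⟩ := hb
    exact (testBit_mulN_fifteen e b).2 ⟨l, hl⟩
  have hdec : ∀ z b, (z, b) ∈ dec (ofRows (t' 0) (t' 1) (t' 2) (t' 3)) ↔ (t' z).testBit b :=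
    fun z b => mem_dec_ofRows ht'
  refine ⟨ofRows (t' 0) (t' 1) (t' 2) (t' 3), ?_, fun y => ⟨?_, ?_⟩⟩
  · refine of_allNormal h (hmem 0) (hmem 1) (hmem 2) (hmem 3) ?_
    intro r hr
    obtain ⟨a, ha, rfl⟩ := List.mem_map.1 hr
    obtain ⟨ha, hrefl⟩ := List.mem_filter.1 ha
    lift a to Fin 4 using List.mem_range.1 ha
    have haa : (a, a) ∈ dec e := by
      rw [mem_dec]
      rwa [show 4 * (a : ℕ) + a = 5 * a by ring]
    obtain ⟨y, hy⟩ := hy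
    obtain ⟨z, hz, hza⟩ := mem_mul.1 (hy.symm ▸ haa)
    have hrow : row e a = t z := by
      refine mask_ext (row_lt e a) (ht z) fun b => Bool.eq_iff_iff.2 ?_
      rw [← mem_dec_row, htx]
      constructor
      · intro hb
        rw [← hx]
        exact mem_mul.2 ⟨a, hza, hb⟩
      · intro hb
        rw [← hy]
        exact mem_mul.2 ⟨z, hz, hb⟩
    have hgood : goodRow e (t z) = true :=
      goodRow_of_subset (ht z) a fun b hb => mem_dec_row.2 (hrow ▸ hb)
    have ht'z : t' z = row e a := by rw [hrow]; exact if_pos hgood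
    fin_cases z <;> simp_all
  · refine mul_eq_of_rows fun z => ?_
    by_cases hg : goodRow e (t z) = true
    · left
      intro b
      rw [hdec, ← htx, show t' z = t z from if_pos hg]
    · right
      intro a
      by_contra! hcon
      exact hg (goodRow_of_subset (ht z) a fun b hb => hcon b ((htx z b).1 hb))
  · refine mul_eq_of_rows fun z => ?_
    by_cases hg : goodRow e (t z) = true
    · left
      intro b
      rw [hdec, ← htx, show t' z = t z from if_pos hg]
    · right
      intro a
      by_contra! hcon
      refine hg (goodRow_of_subset (ht z) a fun b hb => hcon b ?_)
      rw [hdec, show t' z = mulN 15 e from if_neg hg]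
      exact hsub z b hb

end RelCode

namespace RelCode

/-- The converse of a relation. -/
def conv (R : Set (Fin 4 × Fin 4)) : Set (Fin 4 × Fin 4) := Prod.swap ⁻¹' R

theorem conv_conv (R : Set (Fin 4 × Fin 4)) : conv (conv R) = R := rfl

theorem conv_mul (R S : Set (Fin 4 × Fin 4)) : conv (R * S) = conv S * conv R := by
  ext ⟨i, j⟩
  exact exists_congr fun l => and_comm

theorem conv_dec (c : ℕ) : conv (dec c) = dec (trN c) := by
  ext ⟨i, j⟩
  exact dec_trN.symm

theorem conv_eq_iff {R S : Set (Fin 4 × Fin 4)} : conv R = S ↔ R = conv S :=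
  ⟨fun h => h ▸ rfl, fun h => h ▸ rfl⟩

/-- The sum modulo `2`, as bit vectors, of those `b ∈ bs` whose partner `x ∈ xs` satisfies
`y x = e`. -/
def xsum (y e : ℕ) : List ℕ → List ℕ → ℕ
  | x :: xs, b :: bs => bif Nat.beq (mulN y x) e then b ^^^ xsum y e xs bs else xsum y e xs bs
  | _, _ => 0

/-- Codes for an idempotent frame: the idempotent, its normalized vectors, its local units,
functionals up to local units, and an inverse modulo `2` of the incidence matrix. -/
structure FrameCode where
  e : ℕ
  xs : List ℕ
  gs : List ℕ
  ts : List ℕ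
  bs : List ℕ

namespace FrameCode

/-- The bit vectors `bs` encode the inverse modulo `2` of the incidence matrix. -/
def checkInv (D : FrameCode) : Bool :=
  (List.range D.ts.length).all fun s => (List.range D.gs.length).all fun g =>
    force (mulN (D.gs.getD g 0) (D.ts.getD s 0)) fun y =>
      Nat.beq (xsum y D.e D.xs D.bs) (1 <<< (g + D.gs.length * s))

/-- `D.xs` contains all normalized vectors, and dually for functionals. -/
def checkNormal (D : FrameCode) : Bool :=
  allNormal D.e (fun c => D.xs.any (Nat.beq c)) && allNormal (trN D.e) fun c =>
    force (trN c) fun y => D.ts.any fun t => D.gs.any fun g => Nat.beq (mulN g t) y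

/-- `D.gs` lists the local units of `D.e` without repetition. -/
def checkUnits (D : FrameCode) : Bool :=
  (D.gs.all fun g => Nat.beq (mulN D.e g) g && Nat.beq (mulN g D.e) g &&
      D.gs.any fun h => Nat.beq (mulN g h) D.e) &&
    (D.xs.all fun x => force (mulN D.e x) fun g => D.gs.any (Nat.beq g) ||
      !(D.xs.any fun h => Nat.beq (mulN g h) D.e)) &&
    decide D.gs.Nodup

/-- The vectors and functionals are adapted to the idempotent `D.e`. -/
def checkBasic (D : FrameCode) : Bool :=
  Nat.beq (mulN D.e D.e) D.e && Nat.beq (mulN (trN D.e) (trN D.e)) (trN D.e) &&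
    (D.xs.all fun x => Nat.beq (mulN x D.e) x) && (D.ts.all fun t => Nat.beq (mulN D.e t) t) &&
    Nat.beq D.xs.length (D.ts.length * D.gs.length) && Nat.beq D.bs.length D.xs.length &&
    Nat.blt D.e 65536 && D.gs.all (fun g => Nat.blt g 65536)

/-- All the data of `D` are as described. -/
def check (D : FrameCode) : Bool := D.checkBasic && D.checkUnits && D.checkNormal && D.checkInv

end FrameCode

end RelCode

namespace RelCode

theorem cast_testBit_xsum (y e i : ℕ) : ∀ xs bs : List ℕ, bs.length = xs.length →
    (((xsum y e xs bs).testBit i).toNat : ZMod 2) =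
      ∑ q : Fin xs.length, (if mulN y (xs.getD q e) = e then 1 else 0) *
        (((bs.getD q 0).testBit i).toNat : ZMod 2)
  | [], [], _ => by simp [xsum]
  | x :: xs, b :: bs, h => by
    have ih := cast_testBit_xsum y e i xs bs (by simpa using h)
    have hx : ∀ s t : Bool, ((s ^^ t).toNat : ZMod 2) = s.toNat + t.toNat := by decide
    simp only [List.length_cons, Fin.sum_univ_succ]
    simp only [Fin.val_zero, List.getD_cons_zero, Fin.val_succ, List.getD_cons_succ]
    rw [← ih, xsum]
    by_cases hyx : mulN y x = e
    · rw [if_pos hyx, beq_of_eq hyx, cond_true, Nat.testBit_xor, one_mul, ← hx]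
    · have : Nat.beq (mulN y x) e = false := by
        rw [← Bool.not_eq_true]
        exact fun h => hyx (Nat.eq_of_beq_eq_true h)
      rw [if_neg hyx, this, cond_false, zero_mul, zero_add]

theorem det_indicator {R J : Type*} [CommRing R] [Fintype J] [DecidableEq J]
    (p : J → J → Prop) [∀ i j, Decidable (p i j)] :
    (Matrix.of fun i j => if p i j then (1 : R) else 0).det =
      ((Matrix.of fun i j => if p i j then (1 : ℤ) else 0).det : R) := by
  have : Matrix.of (fun i j => if p i j then (1 : R) else 0) =
      (Int.castRingHom R).mapMatrix (Matrix.of fun i j => if p i j then (1 : ℤ) else 0) := by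
    ext i j
    by_cases hp : p i j <;> simp [hp]
  rw [this, ← RingHom.map_det]
  rfl

theorem det_ne_zero_of_mod_two {k J : Type*} [Field k] [CharZero k] [Fintype J] [DecidableEq J]
    (p : J → J → Prop) [∀ i j, Decidable (p i j)] (B : Matrix J J (ZMod 2))
    (h : Matrix.of (fun i j => if p i j then (1 : ZMod 2) else 0) * B = 1) :
    Matrix.det (Matrix.of fun i j => if p i j then (1 : k) else 0) ≠ 0 := by
  have h2 := congrArg Matrix.det h
  rw [Matrix.det_mul, det_indicator, Matrix.det_one] at h2
  rw [det_indicator]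
  intro h0
  rw [Int.cast_eq_zero.1 h0, Int.cast_zero, zero_mul] at h2
  exact zero_ne_one h2

namespace FrameCode

variable {D : FrameCode}

/-- The code of the `(s, γ)`-th functional. -/
def yCode (D : FrameCode) (s : Fin D.ts.length) (γ : Fin D.gs.length) : ℕ :=
  mulN (D.gs.getD γ 0) (D.ts.getD s 0)

theorem testBit_one_shiftLeft (m i : ℕ) : (1 <<< m).testBit i = decide (m = i) := by
  rw [Nat.one_shiftLeft, Nat.testBit_two_pow]

theorem det_ne_zero_of_checkInv {k : Type*} [Field k] [CharZero k]
    [DecidableEq (Fin D.ts.length × Fin D.gs.length)]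
    (hx : D.xs.length = D.ts.length * D.gs.length) (hb : D.bs.length = D.xs.length)
    (h : D.checkInv = true)
    (p : Fin D.ts.length × Fin D.gs.length → Fin D.ts.length × Fin D.gs.length → Prop)
    [∀ i j, Decidable (p i j)]
    (hp : ∀ j q, p j q ↔ mulN (D.yCode j.1 j.2) (D.xs.getD (finProdFinEquiv q) D.e) = D.e) :
    Matrix.det (Matrix.of fun j q => if p j q then (1 : k) else 0) ≠ 0 := by
  refine det_ne_zero_of_mod_two p (Matrix.of fun q l =>
    (((D.bs.getD (finProdFinEquiv q) 0).testBit (finProdFinEquiv l)).toNat : ZMod 2)) ?_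
  ext j l
  simp only [Matrix.mul_apply, Matrix.of_apply, hp]
  rw [checkInv, List.all_eq_true] at h
  have h1 := List.all_eq_true.1 (h j.1 (List.mem_range.2 j.1.2)) j.2 (List.mem_range.2 j.2.2)
  rw [force_eq] at h1
  have h2 := Nat.eq_of_beq_eq_true h1
  have h3 := cast_testBit_xsum (D.yCode j.1 j.2) D.e (finProdFinEquiv l) D.xs D.bs hb
  rw [yCode, h2, testBit_one_shiftLeft] at h3
  have h4 := ((finProdFinEquiv.trans (finCongr hx.symm)).sum_comp fun q : Fin D.xs.length =>
    (if mulN (D.yCode j.1 j.2) (D.xs.getD q D.e) = D.e then (1 : ZMod 2) else 0) *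
        (((D.bs.getD q 0).testBit (finProdFinEquiv l)).toNat : ZMod 2))
  refine (h4.trans h3.symm).trans ?_
  have hiff : (j.2 : ℕ) + D.gs.length * j.1 = (finProdFinEquiv l : Fin _) ↔ j = l :=
    ⟨fun h => finProdFinEquiv.injective (Fin.ext h), fun h => h ▸ rfl⟩
  by_cases hjl : j = l
  · rw [decide_eq_true (hiff.2 hjl), hjl, Matrix.one_apply_eq]
    rfl
  · rw [decide_eq_false (mt hiff.1 hjl), Matrix.one_apply_ne hjl]
    rfl

theorem dec_mul_dec {a b c : ℕ} (h : mulN a b = c) : dec a * dec b = dec c := by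
  rw [← dec_mulN, h]

theorem mul_dec_eq_iff {a b c : ℕ} (hc : c < 65536) : dec a * dec b = dec c ↔ mulN a b = c := by
  rw [← dec_mulN]
  exact ⟨dec_injOn (mulN_lt _ _) hc, fun h => h ▸ rfl⟩

open Classical in
theorem det_dec_ne_zero {k : Type*} [Field k] [CharZero k]
    [DecidableEq (Fin D.ts.length × Fin D.gs.length)] (he : D.e < 65536)
    (hx : D.xs.length = D.ts.length * D.gs.length) (hb : D.bs.length = D.xs.length)
    (h : D.checkInv = true) :
    Matrix.det (Matrix.of fun (j q : Fin D.ts.length × Fin D.gs.length) =>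
      if dec (D.gs.getD j.2 0) * dec (D.ts.getD j.1 0) * dec (D.xs.getD (finProdFinEquiv q) D.e) =
        dec D.e then (1 : k) else 0) ≠ 0 := by
  have hp : ∀ j q : Fin D.ts.length × Fin D.gs.length,
      dec (D.gs.getD j.2 0) * dec (D.ts.getD j.1 0) * dec (D.xs.getD (finProdFinEquiv q) D.e) =
        dec D.e ↔ mulN (D.yCode j.1 j.2) (D.xs.getD (finProdFinEquiv q) D.e) = D.e := fun j q => by
    rw [← dec_mulN, mul_dec_eq_iff he, yCode]
  exact det_ne_zero_of_checkInv hx hb h _ hp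

theorem mulN_self_of_check (D : FrameCode) (h : D.check = true) : mulN D.e D.e = D.e := by
  simp only [check, checkBasic, Bool.and_eq_true, Nat.beq_eq] at h
  tauto

theorem lt_of_check (D : FrameCode) (h : D.check = true) : D.e < 65536 := by
  simp only [check, checkBasic, Bool.and_eq_true, Nat.blt_eq] at h
  tauto

open MonoidAlgebra in
/-- Checked codes yield an idempotent frame. -/
noncomputable def toIdemFrame (D : FrameCode) (k : Type) [Field k] [CharZero k]
    (h : D.check = true) : IdemFrame k (dec D.e) (Fin D.ts.length) (Fin D.gs.length) := by
  simp only [check, checkBasic, checkUnits, checkNormal, Bool.and_eq_true, List.all_eq_true,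
    List.any_eq_true, Bool.or_eq_true, Nat.beq_eq, Nat.blt_eq, decide_eq_true_eq,
    Bool.not_eq_true', force_eq] at h
  obtain ⟨⟨⟨⟨⟨⟨⟨⟨⟨⟨he, he'⟩, hx⟩, ht⟩, hxl⟩, hbl⟩, he0⟩, hg0⟩, ⟨hg, hxg⟩, hnd⟩, hnx, hny⟩,
    hinv⟩ := h
  have hunit : ∀ g ∈ D.gs, IsLocalUnit (dec D.e) (dec g) := by
    intro g hgm
    obtain ⟨⟨h1, h2⟩, w, hw, h3⟩ := hg g hgm
    exact isLocalUnit_of_mul_eq (dec_mul_dec he) (dec_mul_dec h1) (dec_mul_dec h2)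
      (dec_mul_dec (hg w hw).1.1) (dec_mul_dec (hg w hw).1.2) (dec_mul_dec h3)
  have hex : ∀ x, x * dec D.e = x → (∃ y, y * x = dec D.e) →
      ∃ c ∈ D.xs, ∀ y, y * x = dec D.e ↔ y * dec c = dec D.e := by
    intro x hx hy
    obtain ⟨c, hc, h⟩ := exists_normal he hnx hx hy
    rw [List.any_eq_true] at hc
    obtain ⟨c', hc', h'⟩ := hc
    rw [Nat.eq_of_beq_eq_true h'] at h
    exact ⟨c', hc', h⟩
  have hgetg : ∀ γ : Fin D.gs.length, D.gs.getD γ 0 ∈ D.gs := fun γ => by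
    rw [List.getD_eq_getElem _ _ γ.2]
    exact List.getElem_mem _
  exact
  { idem := dec_mul_dec he
    y := fun s => dec (D.ts.getD s 0)
    u := fun γ => dec (D.gs.getD γ 0)
    x := fun q => dec (D.xs.getD (finProdFinEquiv q) D.e)
    idem_mul_y := fun s => by
      refine dec_mul_dec (ht _ ?_)
      rw [List.getD_eq_getElem _ _ s.2]
      exact List.getElem_mem _
    x_mul_idem := fun q => by
      refine dec_mul_dec (hx _ ?_)
      rw [List.getD_eq_getElem _ _ ((finProdFinEquiv q).2.trans_eq hxl.symm)]
      exact List.getElem_mem _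
    isLocalUnit_u := fun γ => hunit _ (hgetg γ)
    u_injective := fun γ γ' h => by
      have h1 := dec_injOn (hg0 _ (hgetg γ)) (hg0 _ (hgetg γ')) h
      rw [List.getD_eq_getElem _ _ γ.2, List.getD_eq_getElem _ _ γ'.2] at h1
      exact Fin.ext ((List.Nodup.getElem_inj_iff hnd).1 h1)
    exists_u := by
      rintro g ⟨hg1, hg2, w, hw1, hw2, hgw, hwg⟩
      obtain ⟨c, hc, hcg⟩ := hex g hg2 ⟨w, hwg⟩
      have hgc : dec (mulN D.e c) = g := by
        rw [dec_mulN, ← hgw, mul_assoc, (hcg w).1 hwg, hg2]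
      obtain ⟨d, hd, hdw⟩ := hex w hw2 ⟨g, hgw⟩
      rcases hxg c hc with ⟨g', hg', hgg⟩ | hno
      · obtain ⟨i, hi, rfl⟩ := List.mem_iff_getElem.1 hg'
        refine ⟨⟨i, hi⟩, ?_⟩
        rw [List.getD_eq_getElem _ _ hi, ← hgg, hgc]
      · have h1 := (hdw g).1 hgw
        rw [← hgc, mul_dec_eq_iff he0] at h1
        rw [List.any_eq_false] at hno
        exact absurd (beq_of_eq h1) (hno d hd)
    exists_x := by
      rintro x hx ⟨y, -, hy⟩
      obtain ⟨c, hc, h⟩ := hex x hx ⟨y, hy⟩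
      obtain ⟨i, hi, rfl⟩ := List.mem_iff_getElem.1 hc
      refine ⟨finProdFinEquiv.symm ⟨i, hxl ▸ hi⟩, fun y' _ => ?_⟩
      rw [h, Equiv.apply_symm_apply, List.getD_eq_getElem _ _ hi]
    exists_y := by
      rintro y hy ⟨x, -, hx⟩
      obtain ⟨c, hc, h⟩ := exists_normal he' hny (x := conv y)
        (by rw [← conv_dec, ← conv_mul, hy]) ⟨conv x, by rw [← conv_mul, hx, conv_dec]⟩
      simp only [List.any_eq_true, Nat.beq_eq] at hc
      obtain ⟨t, ht', g, hg', htg⟩ := hc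
      obtain ⟨i, hi, rfl⟩ := List.mem_iff_getElem.1 ht'
      obtain ⟨j, hj, rfl⟩ := List.mem_iff_getElem.1 hg'
      refine ⟨⟨i, hi⟩, ⟨j, hj⟩, fun x' _ => ?_⟩
      have h1 := h (conv x')
      rw [← conv_mul, ← conv_dec, conv_eq_iff, conv_conv, ← conv_conv (dec c), ← conv_mul,
        conv_eq_iff, conv_conv, conv_dec c, ← htg, dec_mulN] at h1
      rw [List.getD_eq_getElem _ _ hi, List.getD_eq_getElem _ _ hj]
      exact h1
    det_ne_zero := by convert det_dec_ne_zero (k := k) he0 hxl hbl hinv }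

end FrameCode

end RelCode

namespace RelCode

/-- The row vectors `w` with `w e = w`. -/
def fixedRows (e : ℕ) : Finset ℕ := (Finset.range 16).filter fun w => mulN w e = w

/-- The sum of the squared sizes of the principal filters in the lattice `fixedRows e`. -/
def filterInv (e : ℕ) : ℕ :=
  ∑ w ∈ fixedRows e, ((fixedRows e).filter fun v => w ||| v = v).card ^ 2

theorem mem_fixedRows {e w : ℕ} : w ∈ fixedRows e ↔ w < 16 ∧ mulN w e = w := by
  rw [fixedRows, Finset.mem_filter, Finset.mem_range]

theorem mulN_assoc (a b c : ℕ) : mulN (mulN a b) c = mulN a (mulN b c) :=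
  dec_injOn (mulN_lt _ _) (mulN_lt _ _) (by simp only [dec_mulN, mul_assoc])

theorem or_mulN (a b c : ℕ) : mulN (a ||| b) c = mulN a c ||| mulN b c := by
  refine dec_injOn (mulN_lt _ _) (Nat.or_lt_two_pow (n := 16) (mulN_lt _ _) (mulN_lt _ _)) ?_
  have hor : ∀ a b i j, (i, j) ∈ dec (a ||| b) ↔ (i, j) ∈ dec a ∨ (i, j) ∈ dec b := by
    intro a b i j
    simp only [mem_dec, Nat.testBit_or, Bool.or_eq_true]
  ext ⟨i, j⟩
  simp only [hor, dec_mulN, mem_mul, or_and_right, exists_or]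

theorem filterInv_le {a f b e : ℕ} (hf : mulN f f = f) (h : mulN (mulN a f) b = e) :
    filterInv e ≤ filterInv f := by
  let φ : ℕ → ℕ := fun w => mulN w (mulN a f)
  have hφ : ∀ w ∈ fixedRows e, φ w ∈ fixedRows f := by
    intro w hw
    rw [mem_fixedRows] at hw ⊢
    exact ⟨mulN_lt_of_lt hw.1 _, by simp only [φ, mulN_assoc, hf]⟩
  have hinv : ∀ w ∈ fixedRows e, mulN (φ w) b = w := by
    intro w hw
    rw [mem_fixedRows] at hw
    simp only [φ]
    rw [mulN_assoc, h, hw.2]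
  have hinj : Set.InjOn φ (fixedRows e) := fun w hw v hv hwv => by
    rw [← hinv w hw, ← hinv v hv, hwv]
  calc filterInv e
      ≤ ∑ w ∈ fixedRows e, ((fixedRows f).filter fun v => φ w ||| v = v).card ^ 2 := by
        refine Finset.sum_le_sum fun w _ => Nat.pow_le_pow_left ?_ 2
        refine Finset.card_le_card_of_injOn φ (fun v hv => ?_) (hinj.mono fun v hv => ?_)
        · rw [Finset.mem_coe, Finset.mem_filter] at hv ⊢
          refine ⟨hφ v hv.1, ?_⟩
          simp only [φ]
          rw [← or_mulN, hv.2]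
        · exact (Finset.mem_filter.1 hv).1
    _ = ∑ w ∈ (fixedRows e).image φ, ((fixedRows f).filter fun v => w ||| v = v).card ^ 2 :=
        (Finset.sum_image (f := fun w => ((fixedRows f).filter fun v => w ||| v = v).card ^ 2)
          hinj).symm
    _ ≤ filterInv f := Finset.sum_le_sum_of_subset (Finset.image_subset_iff.2 hφ)

end RelCode

namespace RelCode

/-- If `j` belongs to the row `r`, then the row `s` is contained in `r`. -/
def rowTrans (j r s : ℕ) : Bool := !(r.testBit j) || Nat.beq (s &&& r) s

/-- The predicate `P` holds for all transitive relations. -/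
def allTransitive (P : ℕ → Bool) : Bool :=
  (List.range 16).all fun r₀ => (List.range 16).all fun r₁ =>
    !(rowTrans 1 r₀ r₁ && rowTrans 0 r₁ r₀) || (List.range 16).all fun r₂ =>
      !(rowTrans 2 r₀ r₂ && rowTrans 0 r₂ r₀ && rowTrans 2 r₁ r₂ && rowTrans 1 r₂ r₁) ||
        (List.range 16).all fun r₃ =>
          !(rowTrans 3 r₀ r₃ && rowTrans 0 r₃ r₀ && rowTrans 3 r₁ r₃ && rowTrans 1 r₃ r₁ &&
            rowTrans 3 r₂ r₃ && rowTrans 2 r₃ r₂) || force (ofRows r₀ r₁ r₂ r₃) P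

theorem ofRows_row {c : ℕ} (hc : c < 65536) :
    ofRows (row c 0) (row c 1) (row c 2) (row c 3) = c := by
  have hlt : ∀ a i, i ≤ 12 → row c a <<< i < 2 ^ 16 := fun a i hi => by
    rw [Nat.shiftLeft_eq]
    calc row c a * 2 ^ i < 16 * 2 ^ 12 := Nat.mul_lt_mul_of_lt_of_le (row_lt c a)
          (Nat.pow_le_pow_right (by norm_num) hi) (by norm_num)
      _ = 2 ^ 16 := by norm_num
  have h0 : row c 0 < 2 ^ 16 := (row_lt c 0).trans (by norm_num)
  refine dec_injOn (Nat.or_lt_two_pow (n := 16) (Nat.or_lt_two_pow (Nat.or_lt_two_pow h0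
    (hlt 1 4 (by norm_num))) (hlt 2 8 (by norm_num))) (hlt 3 12 (by norm_num))) hc ?_
  ext ⟨a, b⟩
  rw [mem_dec_row (e := c)]
  exact mem_dec_ofRows (t := fun z : Fin 4 => row c z) fun z => row_lt c z

theorem rowTrans_row {c : ℕ} (h : mulN c c = c) (i j : Fin 4) :
    rowTrans j (row c i) (row c j) = true := by
  rw [rowTrans, Bool.or_eq_true, or_iff_not_imp_left, Bool.not_eq_true', Bool.not_eq_false]
  intro hij
  refine beq_of_eq ((and_eq_iff (row_lt c j)).2 fun b hb => ?_)
  rw [← mem_dec_row, ← h, dec_mulN]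
  exact mem_mul.2 ⟨j, mem_dec_row.2 hij, mem_dec_row.2 hb⟩

theorem of_allTransitive {P : ℕ → Bool} (hP : allTransitive P = true) {c : ℕ} (hc : c < 65536)
    (h : mulN c c = c) : P c = true := by
  rw [allTransitive] at hP
  have h1 := List.all_eq_true.1 (List.all_eq_true.1 hP _ (List.mem_range.2 (row_lt c 0))) _
    (List.mem_range.2 (row_lt c 1))
  have t := rowTrans_row h
  have t01 := t 0 1
  have t10 := t 1 0
  have t02 := t 0 2
  have t20 := t 2 0
  have t12 := t 1 2
  have t21 := t 2 1
  have t03 := t 0 3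
  have t30 := t 3 0
  have t13 := t 1 3
  have t31 := t 3 1
  have t23 := t 2 3
  have t32 := t 3 2
  simp only [Fin.val_zero, Fin.val_one, Fin.val_two, show ((3 : Fin 4) : ℕ) = 3 from rfl] at *
  rw [t01, t10] at h1
  have h2 := List.all_eq_true.1 h1 _ (List.mem_range.2 (row_lt c 2))
  rw [t02, t20, t12, t21] at h2
  have h3 := List.all_eq_true.1 h2 _ (List.mem_range.2 (row_lt c 3))
  rw [t03, t30, t13, t31, t23, t32, force_eq, ofRows_row hc] at h3
  exact h3

/-- The diagonal relation on the points of `c` that are the least ones in their class of mutually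
related points. -/
def core (c : ℕ) : ℕ :=
  let p : ℕ → ℕ → Bool := fun a b => c.testBit (4 * a + b) && c.testBit (4 * b + a)
  (bif c.testBit 0 then 1 else 0) |||
    (bif c.testBit 5 && !(p 1 0) then 32 else 0) |||
    (bif c.testBit 10 && !(p 2 0) && !(p 2 1) then 1024 else 0) |||
    (bif c.testBit 15 && !(p 3 0) && !(p 3 1) && !(p 3 2) then 32768 else 0)

/-- The restriction of a relation to its core. -/
def coreRestrict (c : ℕ) : ℕ := mulN (core c) (mulN c (core c))

/-- Permutation matrices together with their inverses. -/
def perms : List (ℕ × ℕ) :=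
  [(33825, 33825), (18465, 18465), (33345, 33345), (10305, 17025), (17025, 10305), (9345, 9345),
    (33810, 33810), (18450, 18450), (33090, 33300), (6210, 16920), (16770, 10260), (5250, 9240),
    (33300, 33090), (10260, 16770), (33060, 33060), (6180, 16680), (8580, 8580), (4740, 8520),
    (16920, 6210), (9240, 5250), (16680, 6180), (5160, 5160), (8520, 4740), (4680, 4680)]

/-- Idempotents in the order of increasing codes, one for each isomorphism class of posets with at
most four elements. -/
def repCodes : List ℕ :=
  [0, 1, 33, 35, 1057, 1059, 1063, 1125, 1127, 33825, 33827, 33831, 33839, 33893, 33895, 33897,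
    33901, 33903, 34029, 34031, 36009, 36011, 36015, 36077, 36079]

/-- An idempotent relation is equivalent to its restriction to its core, and is isomorphic to a
representative if it equals this restriction. -/
def checkIdem (c : ℕ) : Bool :=
  !(Nat.beq (mulN c c) c) || force (coreRestrict c) fun o =>
    bif Nat.beq o c then
      perms.any fun p => force (mulN p.1 (mulN c p.2)) fun d => repCodes.any (Nat.beq d)
    else Nat.beq (mulN c (mulN o c)) c && Nat.beq (mulN o (mulN c o)) o && Nat.beq (mulN o o) o &&
      Nat.beq (coreRestrict o) o

theorem allTransitive_checkIdem : allTransitive checkIdem = true := by decide +kernel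

theorem mulN_perms : ∀ p ∈ perms, mulN p.2 p.1 = 33825 := by decide +kernel

end RelCode

namespace RelCode

def frame0 : FrameCode where
  e := 0
  xs :=
    [0]
  gs :=
    [0]
  ts :=
    [0]
  bs :=
    [1]

theorem check_frame0 : frame0.check = true := by decide +kernel

def frame1 : FrameCode where
  e := 1
  xs :=
    [4096, 256, 4352, 16, 4112, 272, 4368, 1, 4097, 257, 4353, 17, 4113, 273, 4369]
  gs :=
    [1]
  ts :=
    [1, 2, 3, 4, 5, 6, 7, 8, 9, 10, 11, 12, 13, 14, 15]
  bs :=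
    [16448, 17408, 17476, 20480, 20560, 21760, 21845, 24576, 24672, 26112, 26214, 30720, 30840,
    32640, 32767]

theorem check_frame1 : frame1.check = true := by decide +kernel

def frame2 : FrameCode where
  e := 33
  xs :=
    [8448, 4608, 8208, 8464, 528, 4624, 8720, 12816, 8976, 4128, 288, 4384, 8480, 12576, 4640,
    4896, 8496, 4656, 8193, 8449, 513, 4609, 8705, 12801, 8961, 8209, 8465, 529, 4625, 8721,
    12817, 8977, 33, 4129, 8225, 12321, 289, 4385, 8481, 12577, 545, 4641, 8737, 12833, 801,
    4897, 8993, 13089, 8241, 8497, 561, 4657, 8753, 12849, 9009, 4098, 258, 4354, 8450, 12546,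
    4610, 4866, 18, 4114, 8210, 12306, 274, 4370, 8466, 12562, 530, 4626, 8722, 12818, 786, 4882,
    8978, 13074, 4130, 290, 4386, 8482, 12578, 4642, 4898, 4146, 306, 4402, 8498, 12594, 4658,
    4914, 8451, 4611, 8211, 8467, 531, 4627, 8723, 12819, 8979, 4131, 291, 4387, 8483, 12579,
    4643, 4899, 8499, 4659]
  gs :=
    [33, 18]
  ts :=
    [18, 20, 22, 24, 26, 28, 30, 36, 37, 40, 41, 44, 45, 52, 53, 54, 56, 57, 58, 60, 61, 62, 72,
    73, 74, 75, 86, 88, 89, 90, 91, 92, 94, 104, 105, 106, 107, 108, 109, 120, 121, 122, 123,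
    124, 125, 126, 154, 156, 158, 172, 173, 188, 189, 190, 222]
  bs :=
    [38685626227668133590597632, 19342813113834066795298816, 618970019642690137449562112,
    660073497509587529389572096, 40564819207303340847894502572032,
    40564838550117607603465904717824, 40565438177322983540230975389696,
    40565457520137250295802914406400, 40565479280800850437657275138048,
    309485009821345068724781056, 20282409603651670423947251286016,
    20282719088661491770115487694848, 20282448289280203935090055577600,
    20282757774290025281258560421888, 330036748754793764694786048,
    20282739640400425218828637569024, 20283069677151629969673930407936,
    40565149244053320620757842132992, 2475880078570760549798248448, 2524237111355345716786495488,
    162259276829213363391578010288128, 162259296176748843708514450800640,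
    162261752709291934160923901558784, 162261772056827414477862489554944,
    162261801066324718746228328759296, 3249592603124123221610201088,
    3300971950457744961535213568, 212965300838342539451446138503168,
    212965320185879173815787092705280, 212968550430945663586212620795904,
    212968569778482297950556393570304, 212968601810292997208132934434816,
    649037107316853453566312041152512, 649037416877421138637295089352704,
    649039583196968917815009258504192, 649039892757536611893191561445376,
    670587167520733353391755995643904, 670587477081301038463838572249088,
    670589691757884484529381718360064, 670590001318452178608663818207232,
    811454840471095345633077139341312, 811455170588419478540805155586048,
    811457316351210809890570449723392, 811457646468534951805499868192800,
    833014804195289528500720286826496, 833015134312613661409565012393984,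
    833017328432440659647279541527040, 833017658549764801563325937820194,
    649040356909502694549717925232640, 670590468492732990444648416673792,
    862200478561481653861742039531520, 862200808678807012944837351571456,
    862203728154130894856692795713536, 862204058271456262946990181066792,
    883763743257675473794002868775552, 1237940039285380274899124224,
    81129638414606681695789005144064, 81130876354645967080461950779392,
    81129677109677642329661886169088, 81130915049716927714335905546240,
    1262118555677672858393247744, 81130900533162359373114164379648,
    324518553658426726783156020576256, 324519791598484458907504629252096,
    324519172779562096925122116976640, 324520410719619833553070353022976,
    405727420235547672816538569670656, 405728658175605404945285224861696,
    405728080470195938631994602160128, 405729318410253675264341958463504,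
    367618674066186526434043929559040, 367619936184762092002856790917120,
    367619293187321896578209082769408, 367620555305897466650622108499968,
    448832492403464613988526075150336, 448833754522040179561805702500608,
    448833152638112879806215526285312, 448834414756688449883096391749905,
    1624796301562061610805100544, 106482650419171269725723069251584,
    106484275215472831793106310397952, 106482689114244538454404977655808,
    106484313910546100521789628088320, 1650485975228872480767606784,
    106484300905146498604066467217408, 324520178454751347274858962616320,
    431100239280740826930871019765760, 431101864077065447428346397856768,
    431100899515391545097061643845632, 431102524311716170098138058593300,
    367620324552186344960490140073984, 474206961934657586635167366124864,
    81132162663523953248679904673792, 162260538953671999168023460052992,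
    324521803439924510221163439325184, 405730721408936575846408408530944,
    540652980997339839738343917092864, 540654243121818364818118718521344,
    540656230778837623187896249876480, 540657492903316152771273497411584,
    621870100508006830334421206827008, 649038732207602345285315750526976,
    757104320986310010043905989410816, 757105945877058901768682155802624,
    757106845235267060203455592267776, 757108470126015960935432422768640,
    811456491057789797148012058771456, 919533608247560636673667852664832,
    1081725211021317652577526292152320, 1189889809307197996812875994234880]

theorem check_frame2 : frame2.check = true := by decide +kernel

def frame3 : FrameCode where
  e := 35
  xs :=
    [12800, 8960, 12320, 12832, 800, 8992, 13088, 8240, 560, 8752, 12848, 9008, 12290, 12802,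
    770, 8962, 13058, 12322, 12834, 802, 8994, 13090, 50, 8242, 12338, 562, 8754, 12850, 818,
    9010, 13106, 8195, 515, 8707, 12803, 8963, 35, 8227, 12323, 547, 8739, 12835, 803, 8995,
    13091, 8243, 563, 8755, 12851, 9011]
  gs :=
    [35]
  ts :=
    [19, 21, 23, 25, 27, 29, 31, 35, 38, 39, 42, 43, 46, 47, 55, 59, 63, 69, 70, 71, 76, 77, 78,
    79, 87, 93, 95, 103, 110, 111, 127, 137, 138, 139, 140, 141, 142, 143, 155, 157, 159, 171,
    174, 175, 191, 205, 206, 207, 223, 239]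
  bs :=
    [1073823744, 17592186142720, 1157627904, 1157709892, 18966575579136, 18966575677520, 114773,
    281475077373952, 283124244152320, 283124344815712, 117440614, 1924145348728, 1744830464,
    1744921088, 28587302322176, 28587302430720, 125568, 1837629440, 1837720132, 30107720744960,
    30107720853584, 125653, 457396837154816, 457396948303872, 128581632, 459217903288320,
    459218014437472, 128581734, 2106681458688, 2106681458808, 127, 562950758727680,
    576144092954624, 576144898273280, 939537152, 15393162804224, 774056185954304,
    774057003843584, 952893440, 787456483917824, 787457301819392, 952906496, 15612206120960,
    15612206136320, 16256, 246290620350464, 246548302659584, 246548318388224, 16646144,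
    272730423296]

theorem check_frame3 : frame3.check = true := by decide +kernel

def frame4 : FrameCode where
  e := 1057
  xs :=
    [16912, 9232, 16672, 5152, 8512, 4672, 16897, 9217, 16913, 9233, 16417, 16673, 16929, 1057,
    5153, 9249, 17441, 29729, 18209, 8257, 8513, 577, 4673, 8769, 16961, 29249, 9281, 10049,
    17009, 9329, 16642, 5122, 16402, 16658, 16914, 1042, 5138, 9234, 17426, 29714, 18194, 16674,
    5154, 4162, 322, 4418, 8514, 16706, 28994, 4674, 5186, 5954, 16754, 5234, 8452, 4612, 8212,
    8468, 532, 4628, 8724, 16916, 29204, 9236, 10004, 4132, 292, 4388, 8484, 16676, 28964, 4644,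
    5156, 5924, 8516, 4676, 8564, 4724, 16919, 9239, 16679, 5159, 8519, 4679]
  gs :=
    [1057, 577, 1042, 322, 532, 292]
  ts :=
    [292, 296, 300, 328, 330, 360, 584, 585, 600, 840, 857, 874, 1388, 2476]
  bs :=
    [36893488147419103232, 18446744073709551616, 9223372036854775808, 2305843009213693952,
    4611686018427387904, 1152921504606846976, 2361183241434822606848, 1180591620717411303424,
    2398653190334545133568, 1199326595167272566784, 151115727451828646838272,
    151124953075665315299328, 153476910693297829183488, 9671406556917033397649408,
    9671408862768838704365568, 9672587148537751077388288, 9822522284368862044618752,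
    152298624924351633424416, 9673776965782339248588800, 75557863725914323419136,
    75562476537832657649664, 4835703278458516698824704, 4835704431384419352182784,
    4911261142184431022309376, 4838064461699952058302464, 77920199893252336320528,
    76738455346648914591744, 4836888482891169624294400, 4986856475859279973187584,
    9746983155617415034830848, 590295810358705651712, 147573952589676412928,
    37778931862957161709568, 38369227673324457295872, 37815834358303835553792,
    2417851639229258349412352, 2417999213181848059379712, 2417870086043700803141632,
    2455630571092215511154688, 37944952629989325438984, 2418478837534972318876160,
    599663297583636283392, 149915824395909070848, 9444732965739290427392,
    604462909807314587353088, 613907642773053877788672, 604467521510925200785408,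
    605053205617673427222528, 10039640479708743737346, 9445886168718873985024,
    9592306918331114323968, 604611636962885994815616, 642251209157505405943808,
    2427298714066806054060032, 295147905179352825856, 73786976294838206464,
    18889465931478580854784, 19184613836662228647936, 1208925819614629174706176,
    1208999606590924029689856, 1227815285546107755577344, 1208962713243514082164736,
    19000146536658343313412, 18907917179151917776896, 1209239418767486159438080,
    4722366482869645213696, 302231454903657293676544, 306953821386526938894336,
    302526602808836713611264, 302240678310878520541184, 5026737795270292017153,
    4796153459165557161984, 4724672888828812328960, 302307548285912372744256,
    299831648791818141696, 74957912197954535424, 321125604578752702971904,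
    1213649357033403027030016, 1249066520329909228797952, 2437921989586898376458240,
    453937624568566663610368, 9676276533953173223636992, 680315994639769272320000,
    4845221816700891079639040]

theorem check_frame4 : frame4.check = true := by decide +kernel

def frame5 : FrameCode where
  e := 1059
  xs :=
    [17184, 13344, 16944, 9264, 12864, 9024, 17154, 13314, 17186, 13346, 16434, 16946, 17202,
    1074, 9266, 13362, 17458, 29746, 18226, 12354, 12866, 834, 9026, 13122, 17218, 29506, 13378,
    14146, 17266, 13426, 16899, 9219, 16419, 16931, 17187, 1059, 9251, 13347, 17443, 29731,
    18211, 16947, 9267, 8259, 579, 8771, 12867, 16963, 29251, 9027, 9283, 10051, 17011, 9331,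
    12804, 8964, 12324, 12836, 804, 8996, 13092, 17188, 29476, 13348, 14116, 8244, 564, 8756,
    12852, 16948, 29236, 9012, 9268, 10036, 12868, 9028, 12916, 9076, 17191, 13351, 16951, 9271,
    12871, 9031]
  gs :=
    [1059]
  ts :=
    [294, 298, 302, 326, 332, 334, 366, 394, 396, 398, 430, 462, 533, 537, 541, 581, 588, 589,
    605, 649, 652, 653, 669, 717, 844, 861, 878, 908, 925, 942, 1043, 1049, 1051, 1059, 1066,
    1067, 1083, 1161, 1162, 1163, 1179, 1195, 1322, 1339, 1390, 1418, 1435, 1486, 1561, 1595,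
    1629, 1673, 1707, 1741, 2067, 2069, 2071, 2083, 2086, 2087, 2103, 2117, 2118, 2119, 2135,
    2151, 2342, 2359, 2374, 2391, 2478, 2510, 2581, 2615, 2629, 2663, 2717, 2765, 3091, 3107,
    3159, 3175, 3227, 3243]
  bs :=
    [147573952589676412928, 8796093022208, 590295810358705651712, 70368744177664, 33554432,
    268435456, 9444732965739290427392, 562949953421312, 9593459839833573687296, 571814765920256,
    1208925819614629174706176, 1209534562169061589909504, 757541486120736391168,
    4835703278458516698824704, 4835703278529984954630144, 80337363271680,
    6346860552976803167207424, 6346860552985673348415488, 6347009369922889997877248,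
    1125899906842624, 1125899940659200, 75557863725914323419136, 75557863725914596048896,
    306462720, 89724963174523259060224, 89724963174523292897280, 1970324836974592,
    1970325109628928, 90333813815346731155456, 2041799535230976, 37778931862957161709568,
    4503599627370496, 2417851639229258349412352, 2455667464580362930225152,
    47262287699100781510656, 9671406556917033397649408, 9671406561422832048275456,
    5068851683262464, 12693721105953606334414848, 12693721106516667956985856,
    12703167712416790610968576, 3626842022448145507549184, 14507109835379398387171328,
    9007199254740992, 151115727451828646838272, 151115736459027909967872, 10133099170365440,
    207784125246264389402624, 207784126372164296671232, 226673591177742984937472,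
    15762598695796736, 75557879488513026031616, 1416739920820013342130176,
    4835703294222902101016576, 67108864, 536870912, 17592186044416, 17592253153344,
    1180591620717411303424, 1180591620717948175360, 603980868, 1401952549601925922816,
    1401952549601993031749, 30786325577728, 30786862449670, 140737488355328,
    2361183241434822606848, 2361183382172310964224, 158329674401888, 3246626956972881084416,
    3246626974565067128936, 3541774862152233913856, 246290604621824, 1180591867008015926912,
    117440512, 939524096, 140737605797936, 2361183241435762133760, 39218642591834961870848,
    4536636515811328, 2421148994732433931763712, 9671406557166347659247616, 9007199380766720,
    151115727451829597896704]

theorem check_frame5 : frame5.check = true := by decide +kernel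

def frame6 : FrameCode where
  e := 1063
  xs :=
    [29728, 18208, 29248, 10048, 17008, 9328, 29698, 18178, 29730, 18210, 28738, 29250, 29762,
    30274, 1858, 10050, 18242, 26434, 30530, 29794, 18274, 16498, 17010, 1138, 9330, 17522,
    25714, 29810, 18034, 18290, 29188, 9988, 28708, 29220, 29732, 30244, 1828, 10020, 18212,
    26404, 30500, 29252, 10052, 29284, 10084, 8308, 628, 8820, 17012, 25204, 29300, 9332, 9844,
    10100, 29734, 18214, 29254, 10054, 17014, 9334, 16903, 9223, 16423, 16935, 1063, 9255, 17447,
    25639, 29735, 17959, 18215, 8263, 583, 8775, 16967, 25159, 29255, 9287, 9799, 10055, 16999,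
    9319, 17015, 9335]
  gs :=
    [1063, 583]
  ts :=
    [295, 299, 303, 327, 333, 335, 367, 395, 397, 399, 431, 463, 583, 590, 591, 607, 651, 654,
    655, 671, 719, 847, 863, 879, 911, 927, 943, 1165, 1166, 1167, 1183, 1199, 1391, 1423, 1439,
    1487, 1679, 1711, 1743, 2479, 2511, 2767]
  bs :=
    [35184372088832, 2251799813685248, 17592186044416, 1125899906842624, 590295810358705651712,
    295147905179352825856, 140737488355328, 9007199254740992, 184717953466368, 11821949021847552,
    36893488147419103232, 36893505740678889472, 36893628884907466752, 36893646478167253026,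
    604462909807314587353088, 604462910933489372102656, 604462918814513844191232,
    604462919940688628940840, 42, 36893672865372579968, 604462921629263611854848,
    2361183241434822606848, 3099053004383204671488, 2417851639229258349412352,
    2418147940055942309085184, 2420212822470693180407808, 2420509123297377140083200, 2688,
    2420950692233641563127808, 688128, 70368744177664, 4503599627370496, 18446744073709551616,
    18446814442453733376, 18446779260229124096, 18446849628973305873, 302231454903657293676544,
    302231459407256922095616, 302231457156006863175680, 302231461659606491594772, 21,
    92358976733184, 5910974510923776, 18446836432686289984, 302231460814631805927424,
    1180591620717411303424, 1208925819614629174706176, 1210106411235346590203904,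
    1209518421267997094051840, 1210699012888714509550848, 1344, 1549526502191602335744,
    1210475346116820781563904, 344064, 18446928794380926976, 302231466726302100226048,
    36893580507754790912, 604462915718636990627840, 1212027790951570915459072,
    2419402624897729219788800, 37778931862957161709568, 18889465931478580854784,
    151115727451828646838272, 198339392280525098975232, 9671406556917033397649408,
    9690300634534530405892096, 9822522284371061067743232, 9841416361988558747074560, 704643072,
    9869745949199929318572032, 180388626432, 75557863725914323419136, 4835703278458516698824704,
    4911261142185530533871616, 4873491433693510715310080, 4949049297420524885901312, 352321536,
    99169696140262549487616, 4934872974599964659286016, 90194313216, 5034052614687019031855104,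
    9770581225031284564164608, 756604737398243328, 378302368699121664]

theorem check_frame6 : frame6.check = true := by decide +kernel

def frame7 : FrameCode where
  e := 1125
  xs :=
    [25920, 22080, 25680, 18000, 21600, 17760, 25860, 22020, 25924, 22084, 24660, 25684, 25940,
    1620, 18004, 22100, 26196, 30292, 26452, 20580, 21604, 1380, 17764, 21860, 25956, 30052,
    22116, 22372, 25972, 22132, 25605, 17925, 24645, 25669, 25925, 1605, 17989, 22085, 26181,
    30277, 26437, 25685, 18005, 16485, 1125, 17509, 21605, 25701, 29797, 17765, 18021, 18277,
    25717, 18037, 21510, 17670, 20550, 21574, 1350, 17734, 21830, 25926, 30022, 22086, 22342,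
    16470, 1110, 17494, 21590, 25686, 29782, 17750, 18006, 18262, 21606, 17766, 21622, 17782,
    25927, 22087, 25687, 18007, 21607, 17767]
  gs :=
    [1125, 1110]
  ts :=
    [309, 313, 317, 345, 347, 377, 379, 381, 445, 566, 570, 574, 618, 619, 634, 635, 638, 702,
    891, 1110, 1116, 1118, 1132, 1133, 1148, 1149, 1150, 1246, 1405, 1662, 2202, 2204, 2206,
    2220, 2221, 2236, 2237, 2238, 2270, 2493, 2750, 3294]
  bs :=
    [137438961664, 68719480832, 144115188075888640, 604462909807314587484160, 72057594037944320,
    302231454903657293742080, 139586437120, 69793218560, 139586445312, 69793222656,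
    146366987889541120, 146366987889573888, 43008, 613907642773053877780480,
    613907642773053877911552, 135424, 163872, 168226, 174120, 73183493944770560,
    73183493944786944, 306953821386526938890240, 306953821386526938955776, 81936, 74240, 90641,
    21504, 87060, 109184, 152896, 576460760893358080, 2417851639229292709150720,
    585467951558164480, 585467960148099072, 11274289152, 2455630571092215511121920,
    2455630571092249870860288, 35500589056, 42958061568, 44099436544, 45644513280,
    11821949021847552, 49584848070131274743808, 9671406592945830416613376,
    9822522284368862044487680, 9822522320397659063451648, 37225065669984256, 45044792366727168,
    46241610773561344, 156133241839877644877824, 188931552802933227651072,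
    193951373033991439384576, 47861741157089280, 200746692382144195461120, 288230380446679040,
    1208925819614646354575360, 292733975779082240, 292733980074049536, 1227815285546107755560960,
    1227815285546124935430144, 21479030784, 19461570560, 23760994304, 5637144576, 22822256640,
    4835703296472915208306688, 4911261142184431022243840, 4911261160198829531725824,
    22522396183363584, 20406935811522560, 24915208363311104, 94465776401466613825536,
    85592892502012319498240, 104501958099069216751616, 5910974510923776, 24792424035065637371904,
    23930870578544640, 100373346191072097730560, 28621930496, 40080769024, 30012269391773696,
    125880581558993980227584, 42027732460109824, 176277086368368475242496]

theorem check_frame7 : frame7.check = true := by decide +kernel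

def frame8 : FrameCode where
  e := 1127
  xs :=
    [30272, 26432, 29792, 18272, 25712, 18032, 30212, 26372, 30276, 26436, 28772, 29796, 30308,
    1892, 18276, 26468, 30564, 24692, 25716, 1652, 18036, 26228, 30324, 26484, 29702, 18182,
    28742, 29766, 30278, 1862, 18246, 26438, 30534, 29798, 18278, 16502, 1142, 17526, 25718,
    29814, 18038, 18294, 25607, 17927, 24647, 25671, 1607, 17991, 26183, 30279, 26439, 16487,
    1127, 17511, 25703, 29799, 18023, 18279, 25719, 18039]
  gs :=
    [1127]
  ts :=
    [311, 315, 319, 343, 349, 351, 383, 411, 413, 415, 447, 479, 567, 571, 575, 615, 622, 623,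
    639, 683, 686, 687, 703, 751, 895, 959, 1111, 1117, 1119, 1127, 1134, 1135, 1151, 1229, 1230,
    1231, 1247, 1263, 1407, 1503, 1663, 1775, 2203, 2205, 2207, 2219, 2222, 2223, 2239, 2253,
    2254, 2255, 2271, 2287, 2495, 2527, 2751, 2799, 3295, 3311]
  bs :=
    [16777285, 33555462, 274877907048, 18014398509483648, 549755815984, 36028797018966784,
    17059840, 37773312, 17059909, 37774342, 279508418560, 279508418664, 109, 18317863718748160,
    18317863718749824, 1670, 7, 618877943808, 618877945904, 40558784925401088, 40558784925403904,
    2864, 56, 896, 1099512053760, 72057594044743680, 1106490949632, 1106491375616, 446464,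
    72514990875082752, 72514990881898496, 6840320, 28672, 7314866176, 479387069710336,
    288230487820861440, 295548725546188800, 295548837215338496, 112071802880, 469762048,
    7344737673543680, 30786325577728, 2199031840768, 144115188087390208, 2339683434496,
    2339692019712, 153333493563129856, 153333493574664192, 11730944, 229376, 3670016,
    576460941281984512, 588845651278692352, 588845840257253376, 192199786496, 3758096384,
    12596005207801856, 246290604621824, 60129542144, 3940649673949184]

theorem check_frame8 : frame8.check = true := by decide +kernel

def frame9 : FrameCode where
  e := 33825
  xs :=
    [33825, 18465, 33345, 10305, 17025, 9345, 33810, 18450, 33090, 6210, 16770, 5250, 33300,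
    10260, 33060, 6180, 8580, 4740, 16920, 9240, 16680, 5160, 8520, 4680]
  gs :=
    [33825, 18465, 33345, 10305, 17025, 9345, 33810, 18450, 33090, 6210, 16770, 5250, 33300,
    10260, 33060, 6180, 8580, 4740, 16920, 9240, 16680, 5160, 8520, 4680]
  ts :=
    [4680]
  bs :=
    [8388608, 4194304, 2097152, 524288, 1048576, 262144, 131072, 65536, 2048, 32, 1024, 16,
    32768, 8192, 512, 8, 128, 2, 16384, 4096, 256, 4, 64, 1]

theorem check_frame9 : frame9.check = true := by decide +kernel

def frame10 : FrameCode where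
  e := 33827
  xs :=
    [33842, 18482, 33602, 14402, 17282, 13442, 33827, 18467, 33347, 10307, 17027, 9347, 33572,
    14372, 33332, 10292, 12932, 9092, 17192, 13352, 16952, 9272, 12872, 9032]
  gs :=
    [33827, 18467]
  ts :=
    [4684, 4748, 5162, 5258, 6182, 6214, 9241, 9353, 10261, 10309, 18451, 18467]
  bs :=
    [2097152, 1048576, 131072, 8192, 65536, 4096, 8388608, 4194304, 524288, 32768, 262144, 16384,
    512, 32, 2048, 128, 2, 8, 256, 16, 1024, 64, 1, 4]

theorem check_frame10 : frame10.check = true := by decide +kernel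

def frame11 : FrameCode where
  e := 33831
  xs :=
    [34626, 30786, 33906, 18546, 29826, 18306, 34596, 30756, 33396, 10356, 29316, 10116, 33831,
    18471, 33351, 10311, 17031, 9351, 29736, 18216, 29256, 10056, 17016, 9336]
  gs :=
    [33831, 33351]
  ts :=
    [4686, 4750, 5262, 8525, 8589, 9357, 16683, 16779, 17035, 33063, 33095, 33351]
  bs :=
    [524288, 8192, 2097152, 32768, 128, 512, 262144, 4096, 1048576, 16384, 64, 256, 8388608,
    131072, 4194304, 65536, 2048, 1024, 2, 8, 1, 4, 32, 16]

theorem check_frame11 : frame11.check = true := by decide +kernel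

def frame12 : FrameCode where
  e := 33839
  xs :=
    [63554, 36674, 62594, 20354, 34034, 18674, 63524, 36644, 62084, 12164, 33524, 10484, 62504,
    20264, 62024, 12104, 17144, 9464, 33839, 18479, 33359, 10319, 17039, 9359]
  gs :=
    [33839, 18479, 33359, 10319, 17039, 9359]
  ts :=
    [4687, 4751, 5263, 9359]
  bs :=
    [32, 2048, 16, 1024, 131072, 65536, 8, 512, 2, 128, 32768, 8192, 4, 256, 1, 64, 16384, 4096,
    8388608, 4194304, 2097152, 524288, 1048576, 262144]

theorem check_frame12 : frame12.check = true := by decide +kernel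

def frame13 : FrameCode where
  e := 33893
  xs :=
    [34388, 26708, 34148, 22628, 25988, 22148, 34373, 26693, 33893, 18533, 25733, 18053, 34118,
    22598, 33878, 18518, 21638, 17798, 25928, 22088, 25688, 18008, 21608, 17768]
  gs :=
    [33893, 33878]
  ts :=
    [4714, 5228, 6316, 8537, 9308, 10396, 16697, 16954, 18586, 33077, 33334, 33878]
  bs :=
    [524288, 8192, 262144, 4096, 128, 64, 2097152, 32768, 8388608, 131072, 512, 2048, 1048576,
    16384, 4194304, 65536, 256, 1024, 2, 1, 8, 32, 4, 16]

theorem check_frame13 : frame13.check = true := by decide +kernel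

def frame14 : FrameCode where
  e := 33895
  xs :=
    [34660, 30820, 34420, 26740, 30340, 26500, 34630, 30790, 33910, 18550, 29830, 18310, 34375,
    26695, 33895, 18535, 25735, 18055, 30280, 26440, 29800, 18280, 25720, 18040]
  gs :=
    [33895]
  ts :=
    [4718, 4782, 5230, 5326, 6318, 6350, 8541, 8605, 9309, 9421, 10397, 10445, 16699, 16795,
    16955, 17067, 18587, 18603, 33079, 33111, 33335, 33383, 33879, 33895]
  bs :=
    [262144, 4096, 524288, 8192, 64, 128, 1048576, 16384, 4194304, 65536, 256, 1024, 2097152,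
    32768, 8388608, 131072, 512, 2048, 1, 2, 4, 16, 8, 32]

theorem check_frame14 : frame14.check = true := by decide +kernel

def frame15 : FrameCode where
  e := 33897
  xs :=
    [39012, 35172, 38532, 27012, 34452, 26772, 38982, 35142, 38022, 18822, 33942, 18582, 38472,
    26952, 37992, 18792, 25752, 18072, 34377, 26697, 33897, 18537, 25737, 18057]
  gs :=
    [18582, 33897]
  ts :=
    [4713, 4773, 5225, 5315, 6309, 6339, 9306, 9411, 10390, 10435, 18582, 18597]
  bs :=
    [64, 1024, 4, 1, 256, 16, 16384, 262144, 8192, 131072, 4194304, 2097152, 2, 8, 32, 512, 128,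
    2048, 65536, 4096, 1048576, 8388608, 32768, 524288]

theorem check_frame15 : frame15.check = true := by decide +kernel

def frame16 : FrameCode where
  e := 33901
  xs :=
    [55396, 36196, 54916, 28036, 34516, 26836, 55366, 36166, 54406, 19846, 34006, 18646, 54856,
    27976, 54376, 19816, 25816, 18136, 34381, 26701, 33901, 18541, 25741, 18061]
  gs :=
    [33901]
  ts :=
    [4715, 4775, 5229, 5319, 6317, 6347, 8539, 8599, 9310, 9415, 10398, 10443, 16701, 16791,
    16958, 17063, 18590, 18605, 33085, 33115, 33342, 33387, 33886, 33901]
  bs :=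
    [4096, 262144, 64, 128, 524288, 8192, 16384, 1048576, 256, 1024, 4194304, 65536, 1, 2, 4, 16,
    8, 32, 2097152, 32768, 8388608, 131072, 512, 2048]

theorem check_frame16 : frame16.check = true := by decide +kernel

def frame17 : FrameCode where
  e := 33903
  xs :=
    [63588, 36708, 63108, 28548, 34548, 26868, 63558, 36678, 62598, 20358, 34038, 18678, 63048,
    28488, 62568, 20328, 25848, 18168, 34383, 26703, 33903, 18543, 25743, 18063]
  gs :=
    [33903]
  ts :=
    [4719, 4783, 5231, 5327, 6319, 6351, 8543, 8607, 9311, 9423, 10399, 10447, 16703, 16799,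
    16959, 17071, 18591, 18607, 33087, 33119, 33343, 33391, 33887, 33903]
  bs :=
    [4096, 262144, 64, 128, 524288, 8192, 16384, 1048576, 256, 1024, 4194304, 65536, 1, 2, 4, 16,
    8, 32, 2097152, 32768, 8388608, 131072, 512, 2048]

theorem check_frame17 : frame17.check = true := by decide +kernel

def frame18 : FrameCode where
  e := 34029
  xs :=
    [60804, 56964, 59604, 36564, 55524, 36324, 60744, 56904, 58584, 20184, 54504, 19944, 59469,
    36429, 58509, 20109, 34029, 18669, 55374, 36174, 54414, 19854, 34014, 18654]
  gs :=
    [34029, 18669, 34014, 18654]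
  ts :=
    [4731, 5245, 6333, 9342, 10430, 18654]
  bs :=
    [8, 2, 128, 2048, 32, 512, 4, 1, 64, 1024, 16, 256, 32768, 524288, 16384, 262144, 8388608,
    4194304, 8192, 131072, 4096, 65536, 2097152, 1048576]

theorem check_frame18 : frame18.check = true := by decide +kernel

def frame19 : FrameCode where
  e := 34031
  xs :=
    [65156, 61316, 63716, 36836, 59636, 36596, 65096, 61256, 62696, 20456, 58616, 20216, 63566,
    36686, 62606, 20366, 34046, 18686, 59471, 36431, 58511, 20111, 34031, 18671]
  gs :=
    [34031, 18671]
  ts :=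
    [4735, 4799, 5247, 5343, 6335, 6367, 9343, 9455, 10431, 10479, 18655, 18671]
  bs :=
    [2, 8, 32, 512, 128, 2048, 1, 4, 16, 256, 64, 1024, 8192, 131072, 4096, 65536, 2097152,
    1048576, 32768, 524288, 16384, 262144, 8388608, 4194304]

theorem check_frame19 : frame19.check = true := by decide +kernel

def frame20 : FrameCode where
  e := 36009
  xs :=
    [51864, 44184, 51624, 40104, 43464, 39624, 51849, 44169, 51369, 36009, 43209, 35529, 51594,
    40074, 51354, 35994, 39114, 35274, 43404, 39564, 43164, 35484, 39084, 35244]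
  gs :=
    [36009, 35529, 35994, 35274, 35484, 35244]
  ts :=
    [4953, 9066, 17772, 35244]
  bs :=
    [32, 16, 8, 2, 4, 1, 2048, 1024, 131072, 8388608, 65536, 4194304, 512, 128, 32768, 2097152,
    8192, 524288, 256, 64, 16384, 1048576, 4096, 262144]

theorem check_frame20 : frame20.check = true := by decide +kernel

def frame21 : FrameCode where
  e := 36011
  xs :=
    [52136, 48296, 51896, 44216, 47816, 43976, 52106, 48266, 51386, 36026, 47306, 35786, 51851,
    44171, 51371, 36011, 43211, 35531, 47756, 43916, 47276, 35756, 43196, 35516]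
  gs :=
    [36011]
  ts :=
    [4957, 5021, 5435, 5531, 6455, 6487, 9070, 9134, 9787, 9899, 10807, 10855, 17774, 17870,
    18013, 18125, 19543, 19559, 35246, 35278, 35485, 35533, 35995, 36011]
  bs :=
    [16, 4, 32, 8, 1, 2, 1024, 256, 65536, 4194304, 16384, 1048576, 2048, 512, 131072, 8388608,
    32768, 2097152, 64, 128, 4096, 262144, 8192, 524288]

theorem check_frame21 : frame21.check = true := by decide +kernel

def frame22 : FrameCode where
  e := 36015
  xs :=
    [64680, 53160, 64200, 45000, 51960, 44280, 64650, 53130, 63690, 36810, 51450, 36090, 64140,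
    44940, 63660, 36780, 43260, 35580, 51855, 44175, 51375, 36015, 43215, 35535]
  gs :=
    [36015, 35535]
  ts :=
    [4959, 5023, 5535, 9071, 9135, 9903, 17775, 17871, 18127, 35247, 35279, 35535]
  bs :=
    [2, 8, 1, 4, 32, 16, 128, 512, 8192, 524288, 32768, 2097152, 64, 256, 4096, 262144, 16384,
    1048576, 2048, 1024, 131072, 8388608, 65536, 4194304]

theorem check_frame22 : frame22.check = true := by decide +kernel

def frame23 : FrameCode where
  e := 36077
  xs :=
    [60872, 57032, 60632, 52952, 56552, 52712, 60812, 56972, 59612, 36572, 55532, 36332, 60557,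
    52877, 59597, 36557, 51437, 36077, 56462, 52622, 55502, 36302, 51422, 36062]
  gs :=
    [36077, 36062]
  ts :=
    [4987, 5501, 6589, 9083, 9854, 10942, 17789, 18046, 19678, 35261, 35518, 36062]
  bs :=
    [2, 1, 8, 32, 4, 16, 128, 64, 8192, 524288, 4096, 262144, 512, 2048, 32768, 2097152, 131072,
    8388608, 256, 1024, 16384, 1048576, 65536, 4194304]

theorem check_frame23 : frame23.check = true := by decide +kernel

def frame24 : FrameCode where
  e := 36079
  xs :=
    [65224, 61384, 64744, 53224, 60664, 52984, 65164, 61324, 63724, 36844, 59644, 36604, 64654,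
    53134, 63694, 36814, 51454, 36094, 60559, 52879, 59599, 36559, 51439, 36079]
  gs :=
    [36079]
  ts :=
    [4991, 5055, 5503, 5599, 6591, 6623, 9087, 9151, 9855, 9967, 10943, 10991, 17791, 17887,
    18047, 18159, 19679, 19695, 35263, 35295, 35519, 35567, 36063, 36079]
  bs :=
    [1, 2, 4, 16, 8, 32, 64, 128, 4096, 262144, 8192, 524288, 256, 1024, 16384, 1048576, 65536,
    4194304, 512, 2048, 32768, 2097152, 131072, 8388608]

theorem check_frame24 : frame24.check = true := by decide +kernel

end RelCode

namespace RelCode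

/-- The frame codes for all isomorphism classes of posets with at most four elements. -/
def frame : Fin 25 → FrameCode :=
  ![frame0, frame1, frame2, frame3, frame4, frame5, frame6, frame7, frame8, frame9, frame10,
    frame11, frame12, frame13, frame14, frame15, frame16, frame17, frame18, frame19, frame20,
    frame21, frame22, frame23, frame24]

theorem check_frame (i : Fin 25) : (frame i).check = true := by
  fin_cases i
  exacts [check_frame0, check_frame1, check_frame2, check_frame3, check_frame4, check_frame5,
    check_frame6, check_frame7, check_frame8, check_frame9, check_frame10, check_frame11,
    check_frame12, check_frame13, check_frame14, check_frame15, check_frame16, check_frame17,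
    check_frame18, check_frame19, check_frame20, check_frame21, check_frame22, check_frame23,
    check_frame24]

/-- The invariants of the representatives. -/
def frameInv : Fin 25 → ℕ :=
  ![1, 5, 25, 14, 125, 70, 48, 50, 30, 625, 350, 240, 188, 250, 150, 196, 159, 113, 124, 82, 206,
    119, 84, 86, 55]

theorem filterInv_frame : ∀ i, filterInv (frame i).e = frameInv i := by decide +kernel

theorem frameInv_injective : Function.Injective frameInv := by decide +kernel

theorem exists_frame_of_mem_repCodes : ∀ r ∈ repCodes, ∃ i, (frame i).e = r := by decide +kernel

theorem sum_card_frame : ∑ i, (frame i).ts.length * ((frame i).ts.length * (frame i).gs.length) =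
    32920 := by decide +kernel

theorem mulN_identity {c : ℕ} (hc : c < 65536) : mulN 33825 c = c := by
  refine dec_injOn (mulN_lt _ _) hc ?_
  have : dec 33825 = 1 := by
    ext ⟨i, j⟩
    change (33825 : ℕ).testBit (4 * (i : ℕ) + j) ↔ i = j
    revert i j
    decide
  rw [dec_mulN, this, one_mul]

theorem exists_frame_of_coreRestrict_eq {c : ℕ} (hc : c < 65536) (h : mulN c c = c)
    (hcore : coreRestrict c = c) : ∃ i a b, mulN a b = c ∧ mulN b a = (frame i).e := by
  have hP := of_allTransitive allTransitive_checkIdem hc h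
  rw [checkIdem, beq_of_eq h, force_eq, beq_of_eq hcore] at hP
  simp only [Bool.not_true, Bool.false_or, cond_true, List.any_eq_true, force_eq, Nat.beq_eq] at hP
  obtain ⟨p, hp, d, hd, hpd⟩ := hP
  obtain ⟨i, hi⟩ := exists_frame_of_mem_repCodes d hd
  refine ⟨i, mulN c p.2, mulN p.1 c, ?_, ?_⟩
  · rw [mulN_assoc, ← mulN_assoc p.2, mulN_perms p hp, mulN_identity hc, h]
  · rw [mulN_assoc, ← mulN_assoc c, h, hpd, hi]

theorem exists_frame {c : ℕ} (hc : c < 65536) (h : mulN c c = c) :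
    ∃ i a b, mulN a b = c ∧ mulN b a = (frame i).e := by
  by_cases hcore : coreRestrict c = c
  · exact exists_frame_of_coreRestrict_eq hc h hcore
  have hP := of_allTransitive allTransitive_checkIdem hc h
  have hne : Nat.beq (coreRestrict c) c = false := by
    rw [← Bool.not_eq_true]
    exact fun h => hcore (Nat.eq_of_beq_eq_true h)
  rw [checkIdem, beq_of_eq h, force_eq, hne] at hP
  simp only [Bool.not_true, Bool.false_or, cond_false, Bool.and_eq_true, Nat.beq_eq] at hP
  obtain ⟨⟨⟨h1, h2⟩, h3⟩, h4⟩ := hP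
  have hlt : coreRestrict c < 65536 := mulN_lt _ _
  generalize coreRestrict c = o at *
  obtain ⟨i, a, b, hab, hba⟩ := exists_frame_of_coreRestrict_eq hlt h3 h4
  refine ⟨i, mulN c (mulN o a), mulN b (mulN o c), ?_, ?_⟩
  · calc mulN (mulN c (mulN o a)) (mulN b (mulN o c))
        = mulN c (mulN (mulN o (mulN (mulN a b) o)) c) := by simp only [mulN_assoc]
      _ = c := by rw [hab, h3, h3, h1]
  · calc mulN (mulN b (mulN o c)) (mulN c (mulN o a))
        = mulN b (mulN (mulN o (mulN (mulN c c) o)) a) := by simp only [mulN_assoc]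
      _ = mulN (mulN b a) (mulN b a) := by rw [h, h2, ← hab]; simp only [mulN_assoc]
      _ = (frame i).e := by rw [hba, (frame i).mulN_self_of_check (check_frame i)]

theorem frame_isolated {i i' : Fin 25} {u v : Set (Fin 4 × Fin 4)}
    (h : u * dec (frame i).e * v = dec (frame i').e) : i' = i ∨ frameInv i' < frameInv i := by
  obtain ⟨a, -, rfl⟩ := exists_dec u
  obtain ⟨b, -, rfl⟩ := exists_dec v
  rw [← dec_mulN, ← dec_mulN] at h
  have hle := filterInv_le ((frame i).mulN_self_of_check (check_frame i))
    (dec_injOn (mulN_lt _ _) ((frame i').lt_of_check (check_frame i')) h)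
  rw [filterInv_frame, filterInv_frame] at hle
  rcases hle.eq_or_lt with h | h
  exacts [Or.inl (frameInv_injective h), Or.inr h]

theorem exists_frame_of_idem {E : Set (Fin 4 × Fin 4)} (h : E * E = E) :
    ∃ i a b, a * b = E ∧ b * a = dec (frame i).e := by
  obtain ⟨c, hc, rfl⟩ := exists_dec E
  rw [← dec_mulN] at h
  obtain ⟨i, a, b, hab, hba⟩ := exists_frame hc (dec_injOn (mulN_lt _ _) hc h)
  exact ⟨i, dec a, dec b, by rw [← dec_mulN, hab], by rw [← dec_mulN, hba]⟩

/-- The dimension of the radical of the algebra of relations on `Fin 4`. -/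
theorem finrank_jacobson_fin_four (k : Type) [Field k] [CharZero k] :
    Module.finrank k (Submodule.restrictScalars k
      (Ideal.jacobson (⊥ : Ideal (MonoidAlgebra k (Set (Fin 4 × Fin 4)))))) = 32616 := by
  have h := MonoidAlgebra.finrank_jacobson_add (k := k) (fun i => dec (frame i).e) _ _
    (fun i => (frame i).toIdemFrame k (check_frame i)) frameInv
    (fun i i' u v => frame_isolated) (fun E => exists_frame_of_idem)
  simp only [Fintype.card_fin, sum_card_frame] at h
  have hcard : Fintype.card (Set (Fin 4 × Fin 4)) = 65536 := by simp
  omega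

end RelCode

section Transport

variable {X Y : Type}

/-- A bijection of sets induces an isomorphism of the monoids of relations. -/
def relCongr (σ : X ≃ Y) : Set (X × X) ≃* Set (Y × Y) where
  toFun R := {p | (σ.symm p.1, σ.symm p.2) ∈ R}
  invFun R := {p | (σ p.1, σ p.2) ∈ R}
  left_inv R := by ext; simp
  right_inv R := by ext; simp
  map_mul' R S := by
    ext ⟨i, j⟩
    constructor
    · rintro ⟨l, h1, h2⟩
      exact ⟨σ l, by simpa using h1, by simpa using h2⟩
    · rintro ⟨l, h1, h2⟩
      exact ⟨σ.symm l, h1, h2⟩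

theorem finrank_jacobson_congr (k : Type) [Field k] {A B : Type} [Ring A] [Ring B] [Algebra k A]
    [Algebra k B] (f : A ≃ₐ[k] B) :
    Module.finrank k (Submodule.restrictScalars k (Ideal.jacobson (⊥ : Ideal A))) =
      Module.finrank k (Submodule.restrictScalars k (Ideal.jacobson (⊥ : Ideal B))) := by
  have hmem : ∀ {A B : Type} [Ring A] [Ring B] (f : A ≃+* B) (a : A),
      a ∈ Ideal.jacobson (⊥ : Ideal A) → f a ∈ Ideal.jacobson (⊥ : Ideal B) := by
    intro A B _ _ f a ha
    rw [Ideal.mem_jacobson_iff] at ha ⊢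
    intro y
    obtain ⟨z, hz⟩ := ha (f.symm y)
    refine ⟨f z, ?_⟩
    rw [Ideal.mem_bot] at hz ⊢
    simpa using congrArg f hz
  have hmap : (Submodule.restrictScalars k (Ideal.jacobson (⊥ : Ideal A))).map
      (f.toLinearEquiv : A →ₗ[k] B) =
        Submodule.restrictScalars k (Ideal.jacobson (⊥ : Ideal B)) := by
    ext b
    constructor
    · rintro ⟨a, ha, rfl⟩
      exact hmem f.toRingEquiv a ha
    · intro hb
      exact ⟨f.symm b, hmem f.symm.toRingEquiv b hb, f.apply_symm_apply b⟩
  rw [← hmap]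
  exact (LinearEquiv.finrank_map_eq f.toLinearEquiv _).symm

end Transport

/-- For a field `k` of characteristic zero and a set `X` with 4 elements, the Jacobson
radical `J(𝓡_X)` of the algebra of relations `𝓡_X = k𝓒(X,X)` has dimension 32616
as a `k`-vector space. -/
theorem relAlgebra_jacobson_dim (k : Type) [Field k] [CharZero k]
    (X : Type) [Fintype X] (hX : Fintype.card X = 4) :
    Module.finrank k
      (Submodule.restrictScalars k
        (Ideal.jacobson (⊥ : Ideal (MonoidAlgebra k (Set (X × X)))))) = 32616 := by
  have σ : X ≃ Fin 4 := Fintype.equivFinOfCardEq hX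
  rw [finrank_jacobson_congr k (MonoidAlgebra.domCongr k k (relCongr σ))]
  exact RelCode.finrank_jacobson_fin_four k
end

section
/- Let k be an algebraically closed field of characteristic zero and E a finite set. Then the number of isomorphism classes of simple modules over the essential algebra 𝓔_E = k𝓒(E,E)/I_E equals Σ_{[R]} c(Aut(E,R)), where [R] runs over a set of representatives of the Σ_E-conjugacy classes of partial order relations R on E, Aut(E,R) is the stabilizer of R under the conjugation action of the symmetric group Σ_E, and c(G) denotes the number of conjugacy classes of the finite group G. -/
/-- A relation `R` on `E` is inessential if it factors as `R = S ∘ T` through some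
finite set `Y` with `|Y| < |E|`. -/
def Inessential (E : Type) [Fintype E] (R : Set (E × E)) : Prop :=
  ∃ (Y : Type) (iY : Fintype Y) (S : Set (E × Y)) (T : Set (Y × E)),
    @Fintype.card Y iY < Fintype.card E ∧ R = rcomp S T

/-- The essential algebra `𝓔_E = k𝓒(E,E)/I_E`, the quotient of the algebra of relations
by the two-sided ideal `I_E` spanned by the inessential relations. -/
abbrev essentialAlgebra (k E : Type) [Field k] [Fintype E] : Type :=
  (TwoSidedIdeal.span {x : MonoidAlgebra k (Set (E × E)) |
      ∃ R : Set (E × E), Inessential E R ∧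
        x = MonoidAlgebra.of k (Set (E × E)) R}).ringCon.Quotient
/-- The conjugate relation `ᵠR = Δ_σ R Δ_{σ⁻¹} = {(σ(x),σ(y)) | (x,y) ∈ R}`. -/
def conjRel {E : Type} (σ : Equiv.Perm E) (R : Set (E × E)) : Set (E × E) :=
  {p | ∃ q ∈ R, p = (σ q.1, σ q.2)}

theorem conjRel_one {E : Type} (R : Set (E × E)) : conjRel (1 : Equiv.Perm E) R = R := by
  ext p
  constructor
  · rintro ⟨q, hq, rfl⟩
    exact hq
  · intro hp
    exact ⟨p, hp, rfl⟩

theorem conjRel_mul {E : Type} (σ τ : Equiv.Perm E) (R : Set (E × E)) :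
    conjRel (σ * τ) R = conjRel σ (conjRel τ R) := by
  ext p
  constructor
  · rintro ⟨q, hq, rfl⟩
    exact ⟨(τ q.1, τ q.2), ⟨q, hq, rfl⟩, rfl⟩
  · rintro ⟨r, ⟨q, hq, rfl⟩, rfl⟩
    exact ⟨q, hq, rfl⟩

/-- The stabilizer `Aut(E,R)` of a relation `R` under the conjugation action of `Σ_E`. -/
def autRel (E : Type) (R : Set (E × E)) : Subgroup (Equiv.Perm E) where
  carrier := {σ | conjRel σ R = R}
  one_mem' := conjRel_one R
  mul_mem' := by
    intro a b ha hb
    show conjRel (a * b) R = R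
    rw [conjRel_mul, hb, ha]
  inv_mem' := by
    intro a ha
    show conjRel a⁻¹ R = R
    conv_lhs => rw [← ha]
    rw [← conjRel_mul, inv_mul_cancel, conjRel_one]

/-- A relation `R ⊆ E × E` is a partial order relation: reflexive, antisymmetric
and transitive. -/
def IsOrderRel {E : Type} (R : Set (E × E)) : Prop :=
  (∀ x, (x, x) ∈ R) ∧ (∀ x y, (x, y) ∈ R → (y, x) ∈ R → x = y) ∧
  (∀ x y z, (x, y) ∈ R → (y, z) ∈ R → (x, z) ∈ R)

section TraceForms

/-- The linear forms on an algebra that are symmetric and vanish on nilpotent elements. -/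
def traceForms (k A : Type*) [Field k] [Ring A] [Algebra k A] : Submodule k (Module.Dual k A) where
  carrier := {t | (∀ a b, t (a * b) = t (b * a)) ∧ ∀ a, IsNilpotent a → t a = 0}
  add_mem' := by
    rintro s t ⟨hs, hs'⟩ ⟨ht, ht'⟩
    exact ⟨fun a b => by simp [hs a b, ht a b], fun a ha => by simp [hs' a ha, ht' a ha]⟩
  zero_mem' := ⟨fun _ _ => rfl, fun _ _ => rfl⟩
  smul_mem' := by
    rintro c t ⟨ht, ht'⟩
    exact ⟨fun a b => by simp [ht a b], fun a ha => by simp [ht' a ha]⟩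

theorem exists_surjective_algHom_pi_matrix (k A : Type) [Field k] [IsAlgClosed k] [Ring A]
    [Algebra k A] [Module.Finite k A] :
    ∃ (n : ℕ) (d : Fin n → ℕ) (_ : ∀ i, NeZero (d i))
      (φ : A →ₐ[k] Π i, Matrix (Fin (d i)) (Fin (d i)) k),
      Function.Surjective φ ∧ ∀ a, φ a = 0 → a ∈ Ring.jacobson A ∧ IsNilpotent a := by
  have : IsArtinianRing A := IsArtinianRing.of_finite k A
  have hs : IsSemiprimaryRing A := inferInstance
  have := hs.isSemisimpleRing
  obtain ⟨n, d, hd, ⟨e⟩⟩ :=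
    IsSemisimpleRing.exists_algEquiv_pi_matrix_of_isAlgClosed k (A ⧸ Ring.jacobson A)
  refine ⟨n, d, hd, e.toAlgHom.comp (Ideal.Quotient.mkₐ k (Ring.jacobson A)),
    e.surjective.comp Ideal.Quotient.mk_surjective, fun a ha => ?_⟩
  have hmem : a ∈ Ring.jacobson A := by
    rw [← Ideal.Quotient.eq_zero_iff_mem]
    exact e.injective (ha.trans (map_zero e).symm)
  obtain ⟨m, hm⟩ := hs.isNilpotent
  refine ⟨hmem, m, ?_⟩
  have h := Ideal.pow_mem_pow hmem m
  rw [hm] at h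
  exact h

variable {k A : Type} [Field k] [Ring A] [Algebra k A] {n : ℕ} {d : Fin n → ℕ}
  (φ : A →ₐ[k] Π i, Matrix (Fin (d i)) (Fin (d i)) k)

theorem finrank_traceForms [∀ i, NeZero (d i)] (hφ : Function.Surjective φ)
    (hker : ∀ a, φ a = 0 → IsNilpotent a) :
    Module.finrank k (traceForms k A) = n := by
  choose s hs using fun (i : Fin n) (x y : Fin (d i)) =>
    hφ (Pi.single i (Matrix.single x y (1 : k)))
  have heq (t : traceForms k A) (a b : A) (h : φ a = φ b) : t.1 a = t.1 b := by
    rw [← sub_eq_zero, ← map_sub]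
    exact t.2.2 _ (hker _ (by rw [map_sub, h, sub_self]))
  let F : traceForms k A →ₗ[k] (Fin n → k) :=
    { toFun := fun t i => t.1 (s i 0 0)
      map_add' := fun _ _ => rfl
      map_smul' := fun _ _ => rfl }
  have hinj : Function.Injective F := by
    rw [injective_iff_map_eq_zero]
    intro t ht
    have ht0 (i : Fin n) : t.1 (s i 0 0) = 0 := congrFun ht i
    have htxy (i : Fin n) (x y : Fin (d i)) : t.1 (s i x y) = 0 := by
      rw [heq t (s i x y) (s i x 0 * s i 0 y)
        (by rw [map_mul, hs, hs, hs, ← Pi.single_mul, Matrix.single_mul_single_same, one_mul]),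
        t.2.1]
      by_cases hxy : y = x
      · subst hxy
        rw [heq t _ (s i 0 0), ht0]
        rw [map_mul, hs, hs, hs, ← Pi.single_mul, Matrix.single_mul_single_same, one_mul]
      · rw [heq t _ 0, map_zero]
        rw [map_mul, hs, hs, ← Pi.single_mul, Matrix.single_mul_single_of_ne _ _ _ _ hxy, map_zero,
          Pi.single_zero]
    ext a
    have ha : φ a = φ (∑ i, ∑ x, ∑ y, φ a i x y • s i x y) := by
      simp only [map_sum, map_smul, hs]
      conv_lhs => rw [← Finset.univ_sum_single (φ a)]
      refine Finset.sum_congr rfl fun i _ => ?_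
      conv_lhs => rw [Matrix.matrix_eq_sum_single (φ a i)]
      simp only [← AddMonoidHom.single_apply, map_sum]
      refine Finset.sum_congr rfl fun x _ => Finset.sum_congr rfl fun y _ => ?_
      simp only [AddMonoidHom.single_apply]
      rw [← Pi.single_smul, Matrix.smul_single, smul_eq_mul, mul_one]
    rw [heq t _ _ ha]
    simp [htxy]
  have hsurj : Function.Surjective F := by
    intro c
    let t : Module.Dual k A := ∑ i, c i •
      (Matrix.traceLinearMap (Fin (d i)) k k ∘ₗ LinearMap.proj i ∘ₗ φ.toLinearMap)
    have ht (a : A) : t a = ∑ i, c i * Matrix.trace (φ a i) := by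
      simp [t, LinearMap.sum_apply]
    refine ⟨⟨t, fun a b => ?_, fun a ha => ?_⟩, ?_⟩
    · simp only [ht, map_mul, Pi.mul_apply, Matrix.trace_mul_comm (φ a _)]
    · rw [ht]
      refine Finset.sum_eq_zero fun i _ => ?_
      have h : IsNilpotent (φ a i) := (ha.map φ).map (Pi.evalRingHom _ i)
      rw [(Matrix.isNilpotent_trace_of_isNilpotent h).eq_zero, mul_zero]
    · funext i
      change t (s i 0 0) = c i
      rw [ht, Finset.sum_eq_single i]
      · rw [hs, Pi.single_eq_same, Matrix.trace_single_eq_same, mul_one]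
      · intro j _ hj
        rw [hs, Pi.single_eq_of_ne hj, Matrix.trace_zero, mul_zero]
      · simp
  rw [(LinearEquiv.ofBijective F ⟨hinj, hsurj⟩).finrank_eq, Module.finrank_fin_fun]

/-- The column module attached to the `i`-th factor of a map to a product of matrix algebras. -/
@[nolint unusedArguments]
def ColumnModule (_ : A →ₐ[k] Π i, Matrix (Fin (d i)) (Fin (d i)) k) (i : Fin n) : Type :=
  Fin (d i) → k

instance (i : Fin n) : AddCommGroup (ColumnModule φ i) :=
  inferInstanceAs (AddCommGroup (Fin (d i) → k))

instance (i : Fin n) : Module A (ColumnModule φ i) :=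
  Module.compHom (Fin (d i) → k)
    ((Matrix.toLinAlgEquiv' (R := k) (n := Fin (d i))).toRingEquiv.toRingHom.comp
      ((Pi.evalRingHom _ i).comp φ.toRingHom))

/-- The coordinates of an element of a column module. -/
def ColumnModule.coords (i : Fin n) : ColumnModule φ i ≃+ (Fin (d i) → k) :=
  AddEquiv.refl (Fin (d i) → k)

theorem ColumnModule.coords_smul (i : Fin n) (a : A) (w : ColumnModule φ i) :
    coords φ i (a • w) = (φ a i).mulVec (coords φ i w) := rfl

variable [∀ i, NeZero (d i)]

instance (i : Fin n) : Nontrivial (ColumnModule φ i) :=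
  inferInstanceAs (Nontrivial (Fin (d i) → k))

variable {φ}

theorem ColumnModule.isSimpleModule (hφ : Function.Surjective φ) (i : Fin n) :
    IsSimpleModule A (ColumnModule φ i) := by
  refine isSimpleModule_iff_toSpanSingleton_surjective.2 ⟨inferInstance, fun w hw u => ?_⟩
  obtain ⟨j, hj⟩ : ∃ j, coords φ i w j ≠ 0 :=
    Function.ne_iff.1 ((map_ne_zero_iff _ (coords φ i).injective).2 hw)
  obtain ⟨a, ha⟩ :=
    hφ (Pi.single i (Matrix.vecMulVec (coords φ i u) (Pi.single j (coords φ i w j)⁻¹)))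
  refine ⟨a, (coords φ i).injective ?_⟩
  rw [LinearMap.toSpanSingleton_apply, ColumnModule.coords_smul, ha, Pi.single_eq_same]
  funext x
  simp [Matrix.mulVec, dotProduct, Matrix.vecMulVec_apply, Pi.single_apply, hj]

theorem ColumnModule.eq_of_linearEquiv (hφ : Function.Surjective φ) {i j : Fin n}
    (e : ColumnModule φ i ≃ₗ[A] ColumnModule φ j) : i = j := by
  by_contra hij
  obtain ⟨a, ha⟩ := hφ (Pi.single i 1)
  obtain ⟨w, hw⟩ := exists_ne (0 : ColumnModule φ i)
  have h1 : a • w = w := (coords φ i).injective <| by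
    rw [ColumnModule.coords_smul, ha, Pi.single_eq_same, Matrix.one_mulVec]
  have h2 : a • e w = 0 := (coords φ j).injective <| by
    rw [ColumnModule.coords_smul, ha, Pi.single_eq_of_ne (Ne.symm hij), Matrix.zero_mulVec,
      map_zero]
  rw [← map_smul, h1] at h2
  exact hw (e.map_eq_zero_iff.1 h2)

theorem ColumnModule.exists_linearEquiv (hφ : Function.Surjective φ)
    (hker : ∀ a, φ a = 0 → a ∈ Ring.jacobson A) (V : Type) [AddCommGroup V] [Module A V]
    [IsSimpleModule A V] : ∃ i, Nonempty (V ≃ₗ[A] ColumnModule φ i) := by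
  have hV : Nontrivial V := IsSimpleModule.nontrivial A V
  obtain ⟨v, hv⟩ := exists_ne (0 : V)
  have heq (a b : A) (h : φ a = φ b) (u : V) : a • u = b • u := by
    rw [← sub_eq_zero, ← sub_smul]
    exact Module.mem_annihilator.1 (IsSemisimpleModule.jacobson_le_annihilator A V
      (hker _ (by rw [map_sub, h, sub_self]))) u
  choose s hs using fun (i : Fin n) (x y : Fin (d i)) =>
    hφ (Pi.single i (Matrix.single x y (1 : k)))
  obtain ⟨i, x, hix⟩ : ∃ i x, s i x x • v ≠ 0 := by
    by_contra! h
    apply hv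
    rw [← one_smul A v, heq 1 (∑ i, ∑ x, s i x x), Finset.sum_smul]
    · simp only [Finset.sum_smul, h, Finset.sum_const_zero]
    · simp only [map_sum, hs, map_one]
      conv_lhs => rw [← Finset.univ_sum_single (1 : Π i, Matrix (Fin (d i)) (Fin (d i)) k)]
      refine Finset.sum_congr rfl fun i _ => ?_
      rw [Pi.one_apply]
      simp only [← AddMonoidHom.single_apply, ← map_sum]
      congr 1
      exact Matrix.sum_single_one.symm
  choose L hL using fun w : ColumnModule φ i =>
    hφ (Pi.single i (Matrix.vecMulVec (coords φ i w) (Pi.single x 1)))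
  have := ColumnModule.isSimpleModule hφ i
  let f : ColumnModule φ i →ₗ[A] V :=
    { toFun := fun w => L w • v
      map_add' := fun w w' => by
        rw [← add_smul]
        refine heq _ _ ?_ _
        rw [map_add, hL, hL, hL, ← Pi.single_add, ← Matrix.add_vecMulVec, map_add]
      map_smul' := fun a w => by
        rw [RingHom.id_apply, ← mul_smul]
        refine heq _ _ ?_ _
        rw [map_mul, hL, hL, ColumnModule.coords_smul, ← Pi.single_mul_right, Matrix.mul_vecMulVec] }
  rcases LinearMap.bijective_or_eq_zero f with hf | hf
  · exact ⟨i, ⟨(LinearEquiv.ofBijective f hf).symm⟩⟩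
  · refine absurd ?_ hix
    rw [heq _ (L ((coords φ i).symm (Pi.single x 1)))]
    · exact LinearMap.congr_fun hf ((coords φ i).symm (Pi.single x 1))
    · rw [hs, hL, AddEquiv.apply_symm_apply, Matrix.single_eq_single_vecMulVec_single]

open CategoryTheory in
/-- Over an algebraically closed field, the simple modules of a finite-dimensional algebra are
counted by the dimension of its space of trace forms. -/
theorem exists_simple_modules_finrank_traceForms (k A : Type) [Field k] [IsAlgClosed k] [Ring A]
    [Algebra k A] [Module.Finite k A] :
    ∃ M : Fin (Module.finrank k (traceForms k A)) → ModuleCat.{0} A,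
      (∀ i, IsSimpleModule A (M i)) ∧ (∀ i j, Nonempty (M i ≅ M j) → i = j) ∧
      ∀ V : ModuleCat.{0} A, IsSimpleModule A V → ∃ i, Nonempty (V ≅ M i) := by
  obtain ⟨n, d, hd, φ, hφ, hker⟩ := exists_surjective_algHom_pi_matrix k A
  rw [finrank_traceForms φ hφ fun a ha => (hker a ha).2]
  refine ⟨fun i => ModuleCat.of A (ColumnModule φ i),
    fun i => ColumnModule.isSimpleModule hφ i,
    fun i j ⟨e⟩ => ColumnModule.eq_of_linearEquiv hφ e.toLinearEquiv, fun V hV => ?_⟩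
  obtain ⟨i, ⟨e⟩⟩ := ColumnModule.exists_linearEquiv hφ (fun a ha => (hker a ha).1) V
  exact ⟨i, ⟨e.toModuleIso⟩⟩

end TraceForms

section Relations

variable {E : Type}

theorem mem_rel_mul {R S : Set (E × E)} {z x : E} :
    (z, x) ∈ R * S ↔ ∃ y, (z, y) ∈ R ∧ (y, x) ∈ S := Iff.rfl

theorem rel_mul_subset_mul {R R' S S' : Set (E × E)} (hR : R ⊆ R') (hS : S ⊆ S') :
    R * S ⊆ R' * S' := by
  rintro ⟨z, x⟩ ⟨y, hy, hy'⟩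
  exact ⟨y, hR hy, hS hy'⟩

/-- The graph `Δ_σ` of a permutation, as a homomorphism to the monoid of relations. -/
def permRel (E : Type) : Equiv.Perm E →* Set (E × E) where
  toFun σ := {p | p.1 = σ p.2}
  map_one' := rfl
  map_mul' σ τ := by
    ext ⟨z, x⟩
    simp [mem_rel_mul]

theorem mem_permRel {σ : Equiv.Perm E} {z x : E} : (z, x) ∈ permRel E σ ↔ z = σ x := Iff.rfl

theorem mem_permRel_mul {σ : Equiv.Perm E} {R : Set (E × E)} {z x : E} :
    (z, x) ∈ permRel E σ * R ↔ (σ⁻¹ z, x) ∈ R := by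
  simp only [mem_rel_mul, mem_permRel]
  constructor
  · rintro ⟨y, rfl, h⟩
    simpa using h
  · exact fun h => ⟨_, by simp, h⟩

theorem mem_mul_permRel {σ : Equiv.Perm E} {R : Set (E × E)} {z x : E} :
    (z, x) ∈ R * permRel E σ ↔ (z, σ x) ∈ R := by
  simp [mem_rel_mul, mem_permRel]

theorem mem_conjRel {σ : Equiv.Perm E} {R : Set (E × E)} {z x : E} :
    (σ z, σ x) ∈ conjRel σ R ↔ (z, x) ∈ R := by
  constructor
  · rintro ⟨⟨a, b⟩, h, hq⟩
    simp only [Prod.mk.injEq, EmbeddingLike.apply_eq_iff_eq] at hq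
    rwa [hq.1, hq.2]
  · exact fun h => ⟨_, h, rfl⟩

theorem conjRel_eq (σ : Equiv.Perm E) (R : Set (E × E)) :
    conjRel σ R = permRel E σ * R * permRel E σ⁻¹ := by
  ext ⟨z, x⟩
  rw [mem_mul_permRel, mem_permRel_mul]
  simpa using mem_conjRel (σ := σ) (R := R) (z := σ⁻¹ z) (x := σ⁻¹ x)

theorem mem_autRel {σ : Equiv.Perm E} {R : Set (E × E)} :
    σ ∈ autRel E R ↔ conjRel σ R = R := Iff.rfl

theorem mem_iff_of_mem_autRel {σ : Equiv.Perm E} {R : Set (E × E)} (h : σ ∈ autRel E R)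
    {z x : E} : (σ z, σ x) ∈ R ↔ (z, x) ∈ R := by
  conv_lhs => rw [← mem_autRel.1 h]
  exact mem_conjRel

theorem mem_autRel_iff_commute {σ : Equiv.Perm E} {R : Set (E × E)} :
    σ ∈ autRel E R ↔ permRel E σ * R = R * permRel E σ := by
  rw [mem_autRel, conjRel_eq]
  constructor
  · intro h
    conv_rhs => rw [← h]
    rw [mul_assoc, ← map_mul, inv_mul_cancel, map_one, mul_one]
  · intro h
    rw [h, mul_assoc, ← map_mul, mul_inv_cancel, map_one, mul_one]

theorem IsOrderRel.eq_one_of_forall_mem [Finite E] {R : Set (E × E)} (hR : IsOrderRel R)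
    {p : Equiv.Perm E} (hp : ∀ x, (p x, x) ∈ R) : p = 1 := by
  have hpow (n : ℕ) (x : E) : ((p ^ n) x, x) ∈ R := by
    induction n generalizing x with
    | zero => exact hR.1 x
    | succ n ih => exact hR.2.2 _ _ _ (by simpa [pow_succ] using ih (p x)) (hp x)
  ext x
  refine hR.2.1 _ _ (hp x) ?_
  obtain ⟨n, hn⟩ := (isOfFinOrder_of_finite p).mem_powers_iff_mem_zpowers.2
    (⟨-1, zpow_neg_one p⟩ : p⁻¹ ∈ Subgroup.zpowers p)
  have h := hpow n (p x)
  simp only at hn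
  simpa [hn] using h

variable [Fintype E]

theorem Inessential.mul_left {R : Set (E × E)} (h : Inessential E R) (X : Set (E × E)) :
    Inessential E (X * R) := by
  obtain ⟨Y, iY, S, T, hY, rfl⟩ := h
  exact ⟨Y, iY, rcomp X S, T, hY, (rcomp_assoc X S T).symm⟩

theorem Inessential.mul_right {R : Set (E × E)} (h : Inessential E R) (X : Set (E × E)) :
    Inessential E (R * X) := by
  obtain ⟨Y, iY, S, T, hY, rfl⟩ := h
  exact ⟨Y, iY, S, rcomp T X, hY, rcomp_assoc S T X⟩

/-- By Hall's theorem, an essential relation contains the graph of a permutation. -/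
theorem exists_permRel_subset {R : Set (E × E)} (h : ¬ Inessential E R) :
    ∃ σ : Equiv.Perm E, permRel E σ ⊆ R := by
  classical
  by_contra hσ
  have hall := (Fintype.all_card_le_filter_rel_iff_exists_injective
    (fun x y : E => (y, x) ∈ R)).not.2 fun ⟨f, hf, hfR⟩ => hσ
      ⟨Equiv.ofBijective f (Finite.injective_iff_bijective.1 hf), by
        rintro ⟨z, x⟩ (h : z = f x)
        exact h ▸ hfR x⟩
  push Not at hall
  obtain ⟨A, hA⟩ := hall
  refine h ⟨{x // x ∉ A} ⊕ {y // ∃ a ∈ A, (y, a) ∈ R}, inferInstance,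
    {p | Sum.elim (fun a => (p.1, a.1) ∈ R) (fun b => p.1 = b.1) p.2},
    {p | Sum.elim (fun a => a.1 = p.2) (fun b => (b.1, p.2) ∈ R ∧ p.2 ∈ A) p.1}, ?_, ?_⟩
  · rw [Fintype.card_sum, Fintype.card_subtype_compl, Fintype.card_coe, Fintype.card_subtype]
    have := A.card_le_univ
    omega
  · ext ⟨z, x⟩
    constructor
    · intro hzx
      by_cases hx : x ∈ A
      · exact ⟨Sum.inr ⟨z, x, hx, hzx⟩, rfl, hzx, hx⟩
      · exact ⟨Sum.inl ⟨x, hx⟩, hzx, rfl⟩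
    · rintro ⟨a | b, h1, h2⟩
      · obtain rfl : a.1 = x := h2
        exact h1
      · obtain rfl : z = b.1 := h1
        exact h2.1

/-- An essential preorder is an order. -/
theorem isOrderRel_of_not_inessential {R : Set (E × E)} (h : ¬ Inessential E R) (h1 : 1 ⊆ R)
    (h2 : R * R = R) : IsOrderRel R := by
  classical
  have htrans (x y z : E) (hxy : (x, y) ∈ R) (hyz : (y, z) ∈ R) : (x, z) ∈ R := by
    rw [← h2]
    exact ⟨y, hxy, hyz⟩
  refine ⟨fun x => h1 rfl, fun x y hxy hyx => by_contra fun hne => h ?_, htrans⟩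
  refine ⟨{z // z ≠ x}, inferInstance, {p | (p.1, p.2.1) ∈ R}, {p | (p.1.1, p.2) ∈ R},
    Fintype.card_subtype_lt (x := x) (by simp), ?_⟩
  ext ⟨z, w⟩
  constructor
  · intro hzw
    by_cases hz : z = x
    · subst hz
      exact ⟨⟨y, Ne.symm hne⟩, hxy, htrans _ _ _ hyx hzw⟩
    · exact ⟨⟨z, hz⟩, h1 rfl, hzw⟩
  · rintro ⟨a, ha, ha'⟩
    exact htrans _ _ _ ha ha'

theorem exists_isIdempotentElem_pow {M : Type*} [Monoid M] [Finite M] (x : M) :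
    ∃ n, 0 < n ∧ IsIdempotentElem (x ^ n) := by
  obtain ⟨i, j, hij, h⟩ := Finite.exists_ne_map_eq_of_infinite fun n : ℕ => x ^ (n + 1)
  wlog hlt : i < j generalizing i j
  · exact this j i hij.symm h.symm (by omega)
  obtain ⟨p, rfl⟩ := Nat.exists_eq_add_of_lt hlt
  have hper (m : ℕ) (q : ℕ) : x ^ (i + 1 + m + q * (p + 1)) = x ^ (i + 1 + m) := by
    induction q with
    | zero => simp
    | succ q ih =>
      rw [← ih, show i + 1 + m + (q + 1) * (p + 1) = (i + p + 1 + 1) + (m + q * (p + 1)) by ring,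
        pow_add, ← h, ← pow_add]
      congr 1
      ring
  refine ⟨(i + 1) * (p + 1), by positivity, ?_⟩
  have hm := hper ((i + 1) * p) (i + 1)
  rw [show i + 1 + (i + 1) * p = (i + 1) * (p + 1) by ring] at hm
  rwa [IsIdempotentElem, ← pow_add]

/-- A relation has a power that is idempotent; if that power is essential, then it is an order,
and multiplying once more by the relation amounts to multiplying by an automorphism. -/
theorem exists_pow_eq_order_mul_perm (X : Set (E × E)) :
    ∃ n, 0 < n ∧ IsIdempotentElem (X ^ n) ∧ (Inessential E (X ^ n) ∨ IsOrderRel (X ^ n) ∧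
      ∃ σ ∈ autRel E (X ^ n), X ^ (n + 1) = X ^ n * permRel E σ) := by
  classical
  obtain ⟨n₀, hn₀, hid⟩ := exists_isIdempotentElem_pow X
  set c := Fintype.card (Equiv.Perm E)
  have hcpos : 0 < c := Fintype.card_pos
  obtain ⟨n, hn⟩ : ∃ n, n₀ * c = n + 1 := ⟨n₀ * c - 1, by have := Nat.mul_pos hn₀ hcpos; omega⟩
  have hid' : IsIdempotentElem (X ^ (n + 1)) := by
    rw [← hn, pow_mul]
    exact hid.pow _
  refine ⟨n + 1, n.succ_pos, hid', or_iff_not_imp_left.2 fun hess => ?_⟩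
  obtain ⟨σ, hσ⟩ := exists_permRel_subset (R := X) fun h => hess (pow_succ X n ▸ h.mul_left _)
  have hpow (m : ℕ) : permRel E (σ ^ m) ⊆ X ^ m := by
    induction m with
    | zero => simp
    | succ m ih =>
      rw [pow_succ, pow_succ, map_mul]
      exact rel_mul_subset_mul ih hσ
  have hσn : σ ^ (n + 1) = 1 := by rw [← hn, mul_comm, pow_mul, pow_card_eq_one, one_pow]
  have h1 : 1 ⊆ X ^ (n + 1) := by
    have := hpow (n + 1)
    rwa [hσn, map_one] at this
  have hinv : permRel E (σ ^ n) * permRel E σ = 1 := by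
    rw [← map_mul, ← pow_succ, hσn, map_one]
  have hinv' : permRel E σ * permRel E (σ ^ n) = 1 := by
    rw [← map_mul, ← pow_succ', hσn, map_one]
  have hXr : X ⊆ X ^ (n + 1) * permRel E σ := by
    conv_lhs => rw [← mul_one X, ← hinv, ← mul_assoc]
    refine rel_mul_subset_mul ?_ subset_rfl
    rw [pow_succ']
    exact rel_mul_subset_mul subset_rfl (hpow n)
  have hXl : X ⊆ permRel E σ * X ^ (n + 1) := by
    conv_lhs => rw [← one_mul X, ← hinv', mul_assoc]
    refine rel_mul_subset_mul subset_rfl ?_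
    rw [pow_succ]
    exact rel_mul_subset_mul (hpow n) subset_rfl
  have hr : X ^ (n + 1) * X = X ^ (n + 1) * permRel E σ := by
    refine (rel_mul_subset_mul subset_rfl hXr).trans_eq ?_ |>.antisymm
      (rel_mul_subset_mul subset_rfl hσ)
    rw [← mul_assoc, hid'.eq]
  have hl : X * X ^ (n + 1) = permRel E σ * X ^ (n + 1) := by
    refine (rel_mul_subset_mul hXl subset_rfl).trans_eq ?_ |>.antisymm
      (rel_mul_subset_mul hσ subset_rfl)
    rw [mul_assoc, hid'.eq]
  refine ⟨isOrderRel_of_not_inessential hess h1 hid', σ, ?_, ?_⟩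
  · rw [mem_autRel_iff_commute, ← hl, ← hr, ← pow_succ, ← pow_succ']
  · rw [pow_succ, hr]

end Relations

section OrderForms

variable {E : Type}

/-- `Transports R X a b` says that `X` carries the permutation `b` to `a` modulo the relation `R`,
in the sense that `Δ_a ⊆ X Δ_b ⊆ Δ_a R`. -/
def Transports (R X : Set (E × E)) (a b : Equiv.Perm E) : Prop :=
  (∀ x, (a x, b x) ∈ X) ∧ ∀ z x, (a z, b x) ∈ X → (z, x) ∈ R

theorem transports_one_iff {R : Set (E × E)} (hR : IsOrderRel R) {a b : Equiv.Perm E} :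
    Transports R 1 a b ↔ a = b := by
  constructor
  · rintro ⟨h, -⟩
    ext x
    exact h x
  · rintro rfl
    refine ⟨fun x => rfl, fun z x h => ?_⟩
    rw [a.injective h]
    exact hR.1 x

theorem Transports.left_unique {R X : Set (E × E)} (hR : IsOrderRel R) {a a' b : Equiv.Perm E}
    (h : Transports R X a b) (h' : Transports R X a' b) : a = a' := by
  ext x
  obtain ⟨y, hy⟩ := a'.surjective (a x)
  have h1 : (y, x) ∈ R := h'.2 y x (hy ▸ h.1 x)
  have h2 : (x, y) ∈ R := h.2 x y (hy ▸ h'.1 y)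
  rw [← hy, hR.2.1 _ _ h1 h2]

/-- A relation carrying a permutation modulo an order does so through an injective map whenever it
factors. -/
theorem Transports.exists_injective {R : Set (E × E)} (hR : IsOrderRel R) {Y : Type}
    {S : Set (E × Y)} {T : Set (Y × E)} {a c : Equiv.Perm E}
    (h : Transports R (rcomp S T) a c) :
    ∃ f : E → Y, Function.Injective f ∧ (∀ x, (a x, f x) ∈ S) ∧ ∀ x, (f x, c x) ∈ T := by
  choose f hS hT using h.1
  refine ⟨f, fun x y hxy => hR.2.1 _ _ (h.2 _ _ ⟨f x, hS x, ?_⟩) (h.2 _ _ ⟨f y, hS y, ?_⟩), hS, hT⟩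
  · exact hxy ▸ hT y
  · exact hxy ▸ hT x

theorem transports_mul_iff [Finite E] {R X Y : Set (E × E)} (hR : IsOrderRel R)
    {a c : Equiv.Perm E} :
    Transports R (X * Y) a c ↔ ∃ b, Transports R X a b ∧ Transports R Y b c := by
  constructor
  · intro h
    obtain ⟨f, hf, hX, hY⟩ := h.exists_injective hR
    refine ⟨Equiv.ofBijective f (Finite.injective_iff_bijective.1 hf),
      ⟨hX, fun z x hzx => h.2 z x ⟨f x, hzx, hY x⟩⟩, hY, fun z x hzx => h.2 z x ⟨f z, hX z, hzx⟩⟩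
  · rintro ⟨b, hX, hY⟩
    refine ⟨fun x => ⟨b x, hX.1 x, hY.1 x⟩, fun z x hzx => ?_⟩
    obtain ⟨y, hy, hy'⟩ := hzx
    obtain ⟨y, rfl⟩ := b.surjective y
    exact hR.2.2 _ _ _ (hX.2 _ _ hy) (hY.2 _ _ hy')

theorem transports_mul_right_iff {R X : Set (E × E)} {g : Equiv.Perm E} (hg : g ∈ autRel E R)
    {a b : Equiv.Perm E} : Transports R X (a * g) (b * g) ↔ Transports R X a b := by
  refine and_congr (g.forall_congr_right (q := fun x => (a x, b x) ∈ X))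
    ⟨fun h z x hzx => ?_, fun h z x hzx => (mem_iff_of_mem_autRel hg).1 (h (g z) (g x) hzx)⟩
  obtain ⟨z, rfl⟩ := g.surjective z
  obtain ⟨x, rfl⟩ := g.surjective x
  exact (mem_iff_of_mem_autRel hg).2 (h z x hzx)

theorem transports_order_mul_permRel_self {R : Set (E × E)} (hR : IsOrderRel R)
    {g : Equiv.Perm E} (hg : g ∈ autRel E R) : Transports R (R * permRel E g) (1 * g) 1 := by
  refine ⟨fun x => mem_mul_permRel.2 (hR.1 _), fun z x h => ?_⟩
  exact (mem_iff_of_mem_autRel hg).1 (mem_mul_permRel.1 h)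

theorem Transports.eq_conj_and_subset [Finite E] {R S : Set (E × E)} (hS : IsOrderRel S)
    {g σ b : Equiv.Perm E} (hg : g ∈ autRel E R)
    (h : Transports R (S * permRel E σ) (b * g) b) : σ = b * g * b⁻¹ ∧ S ⊆ conjRel b R := by
  have h1 (x : E) : ((b * g) x, σ (b x)) ∈ S := mem_mul_permRel.1 (h.1 x)
  have hσ : b * g * b⁻¹ * σ⁻¹ = 1 := hS.eq_one_of_forall_mem fun y => by
    simpa using h1 (b⁻¹ (σ⁻¹ y))
  have hσ : σ = b * g * b⁻¹ := (mul_inv_eq_one.1 hσ).symm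
  refine ⟨hσ, ?_⟩
  rintro ⟨u, v⟩ huv
  obtain ⟨z, rfl⟩ := (b * g).surjective u
  obtain ⟨x, rfl⟩ := (b * g).surjective v
  refine mem_conjRel.2 ((mem_iff_of_mem_autRel hg).2 (h.2 z x (mem_mul_permRel.2 ?_)))
  rw [hσ]
  simpa using huv

theorem conjRel_mul_permRel {R : Set (E × E)} {σ π g c : Equiv.Perm E} (hc : c ∈ autRel E R)
    (h : c * g * c⁻¹ = π⁻¹ * σ * π) :
    conjRel π R * permRel E σ = permRel E (π * c) * (R * permRel E g) * permRel E (π * c)⁻¹ := by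
  have hσ : (π * c)⁻¹ * σ = g * (π * c)⁻¹ := by
    rw [← mul_inv_eq_iff_eq_mul, inv_inv, mul_inv_rev]
    calc c⁻¹ * π⁻¹ * σ * (π * c) = c⁻¹ * (π⁻¹ * σ * π) * c := by group
      _ = g := by rw [← h]; group
  conv_lhs => rw [← mem_autRel.1 hc, ← conjRel_mul, conjRel_eq, mul_assoc, ← map_mul, hσ]
  simp only [map_mul, mul_assoc]

theorem ncard_conjRel (σ : Equiv.Perm E) (R : Set (E × E)) : (conjRel σ R).ncard = R.ncard := by
  have h : conjRel σ R = Prod.map σ σ '' R := by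
    ext p
    exact ⟨fun ⟨q, hq, h⟩ => ⟨q, hq, h.symm⟩, fun ⟨q, hq, h⟩ => ⟨q, hq, h.symm⟩⟩
  rw [h, Set.ncard_image_of_injective _ (σ.injective.prodMap σ.injective)]

variable (k : Type) [Field k] [Fintype E]

open scoped Classical

/-- The action of the monoid of relations by partial functions on the set of permutations,
relative to an order. -/
noncomputable def orderMatrix {R : Set (E × E)} (hR : IsOrderRel R) :
    Set (E × E) →* Matrix (Equiv.Perm E) (Equiv.Perm E) k where
  toFun X := Matrix.of fun a b => if Transports R X a b then 1 else 0
  map_one' := by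
    ext a b
    simp [transports_one_iff hR, Matrix.one_apply]
  map_mul' X Y := by
    ext a c
    simp only [Matrix.of_apply, Matrix.mul_apply]
    by_cases h : Transports R (X * Y) a c
    · obtain ⟨b, hX, hY⟩ := (transports_mul_iff hR).1 h
      rw [if_pos h, Finset.sum_eq_single b]
      · rw [if_pos hX, if_pos hY, one_mul]
      · intro b' _ hb'
        rw [if_neg (show ¬ Transports R Y b' c from fun hY' => hb' (hY'.left_unique hR hY)),
          mul_zero]
      · simp
    · rw [if_neg h, Finset.sum_eq_zero]
      intro b _
      by_cases hX : Transports R X a b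
      · rw [if_neg (show ¬ Transports R Y b c from
          fun hY => h ((transports_mul_iff hR).2 ⟨b, hX, hY⟩)), mul_zero]
      · rw [if_neg hX, zero_mul]

theorem orderMatrix_of_inessential {R X : Set (E × E)} (hR : IsOrderRel R)
    (hX : Inessential E X) : orderMatrix k hR X = 0 := by
  obtain ⟨Y, iY, S, T, hY, rfl⟩ := hX
  ext a b
  refine if_neg fun h => ?_
  obtain ⟨f, hf, -⟩ := h.exists_injective hR
  exact hY.not_ge (Fintype.card_le_of_injective f hf)

/-- The quotient map onto the essential algebra. -/
noncomputable def essentialMk (k E : Type) [Field k] [Fintype E] :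
    MonoidAlgebra k (Set (E × E)) →ₐ[k] essentialAlgebra k E :=
  RingCon.mkₐ k _

theorem essentialMk_surjective : Function.Surjective (essentialMk k E) :=
  RingCon.mkₐ_surjective _

/-- The class of a relation in the essential algebra. -/
noncomputable def essentialClass (k E : Type) [Field k] [Fintype E] :
    Set (E × E) →* essentialAlgebra k E :=
  (essentialMk k E : MonoidAlgebra k (Set (E × E)) →* essentialAlgebra k E).comp
    (MonoidAlgebra.of k _)

theorem essentialClass_of_inessential {X : Set (E × E)} (hX : Inessential E X) :
    essentialClass k E X = 0 := by
  have h : MonoidAlgebra.of k (Set (E × E)) X ∈ TwoSidedIdeal.span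
      {x | ∃ R, Inessential E R ∧ x = MonoidAlgebra.of k (Set (E × E)) R} :=
    TwoSidedIdeal.subset_span ⟨X, hX, rfl⟩
  exact (RingCon.eq _).2 ((TwoSidedIdeal.mem_iff _ _).1 h)

instance : Module.Finite k (essentialAlgebra k E) :=
  Module.Finite.of_surjective (essentialMk k E).toLinearMap (essentialMk_surjective k)

variable {k}

theorem essentialAlgebra_hom_ext {M : Type*} [AddCommGroup M] [Module k M]
    {f g : essentialAlgebra k E →ₗ[k] M}
    (h : ∀ X, f (essentialClass k E X) = g (essentialClass k E X)) : f = g := by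
  ext a
  obtain ⟨a, rfl⟩ := essentialMk_surjective k a
  induction a using MonoidAlgebra.induction_on with
  | of X => exact h X
  | add x y hx hy => simp only [map_add, hx, hy]
  | smul r x hx => simp only [map_smul, hx]

variable (k)

/-- The matrix representation of the essential algebra attached to an order. -/
noncomputable def essentialMatrix {R : Set (E × E)} (hR : IsOrderRel R) :
    essentialAlgebra k E →ₐ[k] Matrix (Equiv.Perm E) (Equiv.Perm E) k :=
  RingCon.liftₐ _ (MonoidAlgebra.lift k _ _ (orderMatrix k hR)) fun x y hxy => by
    have hle : TwoSidedIdeal.span {x : MonoidAlgebra k (Set (E × E)) |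
        ∃ R : Set (E × E), Inessential E R ∧ x = MonoidAlgebra.of k (Set (E × E)) R} ≤
        TwoSidedIdeal.ker (MonoidAlgebra.lift k _ _ (orderMatrix k hR)) := by
      rw [TwoSidedIdeal.span_le]
      rintro _ ⟨X, hX, rfl⟩
      change _ ∈ TwoSidedIdeal.ker _
      rw [TwoSidedIdeal.mem_ker, MonoidAlgebra.lift_of, orderMatrix_of_inessential k hR hX]
    have h := (TwoSidedIdeal.mem_ker _).1 (hle ((TwoSidedIdeal.rel_iff _ _ _).1 hxy))
    rw [map_sub, sub_eq_zero] at h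
    exact h

theorem essentialMatrix_essentialClass {R : Set (E × E)} (hR : IsOrderRel R) (X : Set (E × E)) :
    essentialMatrix k hR (essentialClass k E X) = orderMatrix k hR X :=
  MonoidAlgebra.lift_of _ _

/-- The matrix of right multiplication by a permutation. -/
noncomputable def rightMulMatrix (g : Equiv.Perm E) :
    Matrix (Equiv.Perm E) (Equiv.Perm E) k :=
  Matrix.of fun a b => if b = a * g then 1 else 0

theorem mul_rightMulMatrix_apply (M : Matrix (Equiv.Perm E) (Equiv.Perm E) k)
    (g a b : Equiv.Perm E) : (M * rightMulMatrix k g) a (b * g) = M a b := by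
  simp [Matrix.mul_apply, rightMulMatrix]

theorem rightMulMatrix_mul_apply (M : Matrix (Equiv.Perm E) (Equiv.Perm E) k)
    (g a b : Equiv.Perm E) : (rightMulMatrix k g * M) a b = M (a * g) b := by
  simp [Matrix.mul_apply, rightMulMatrix]

theorem commute_essentialMatrix {R : Set (E × E)} (hR : IsOrderRel R) {g : Equiv.Perm E}
    (hg : g ∈ autRel E R) (x : essentialAlgebra k E) :
    Commute (essentialMatrix k hR x) (rightMulMatrix k g) := by
  have h : (LinearMap.mulRight k (rightMulMatrix k g)) ∘ₗ (essentialMatrix k hR).toLinearMap =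
      (LinearMap.mulLeft k (rightMulMatrix k g)) ∘ₗ (essentialMatrix k hR).toLinearMap := by
    refine essentialAlgebra_hom_ext fun X => ?_
    simp only [LinearMap.comp_apply, AlgHom.toLinearMap_apply, LinearMap.mulRight_apply,
      LinearMap.mulLeft_apply, essentialMatrix_essentialClass]
    ext a b
    obtain ⟨b, rfl⟩ : ∃ b', b = b' * g := ⟨b * g⁻¹, by simp⟩
    rw [mul_rightMulMatrix_apply, rightMulMatrix_mul_apply]
    simp [orderMatrix, transports_mul_right_iff hg]
  exact LinearMap.congr_fun h x

/-- The trace form of the essential algebra attached to an automorphism of an order. -/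
noncomputable def orderForm {R : Set (E × E)} (hR : IsOrderRel R) (g : autRel E R) :
    traceForms k (essentialAlgebra k E) :=
  ⟨Matrix.traceLinearMap _ k k ∘ₗ LinearMap.mulRight k (rightMulMatrix k g.1) ∘ₗ
    (essentialMatrix k hR).toLinearMap, fun a b => by
      simp only [LinearMap.comp_apply, AlgHom.toLinearMap_apply, LinearMap.mulRight_apply,
        Matrix.traceLinearMap_apply, map_mul]
      rw [mul_assoc, Matrix.trace_mul_comm, mul_assoc, mul_assoc,
        (commute_essentialMatrix k hR g.2 a).eq], fun a ha => by
      simp only [LinearMap.comp_apply, AlgHom.toLinearMap_apply, LinearMap.mulRight_apply,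
        Matrix.traceLinearMap_apply]
      exact (Matrix.isNilpotent_trace_of_isNilpotent
        ((commute_essentialMatrix k hR g.2 a).isNilpotent_mul_right
          (ha.map (essentialMatrix k hR)))).eq_zero⟩

theorem orderForm_essentialClass {R : Set (E × E)} (hR : IsOrderRel R) (g : autRel E R)
    (X : Set (E × E)) : (orderForm k hR g).1 (essentialClass k E X) =
      (Finset.univ.filter fun b : Equiv.Perm E => Transports R X (b * g.1) b).card := by
  simp only [orderForm, LinearMap.comp_apply, AlgHom.toLinearMap_apply, LinearMap.mulRight_apply,
    Matrix.traceLinearMap_apply, essentialMatrix_essentialClass, Matrix.trace, Matrix.diag_apply]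
  rw [← Equiv.sum_comp (Equiv.mulRight g.1)]
  simp only [Equiv.coe_mulRight, mul_rightMulMatrix_apply]
  simp [orderMatrix]

variable {k}

/-- A trace form on the essential algebra takes the same values on conjugate relations. -/
theorem traceForms_essentialClass_conj (t : traceForms k (essentialAlgebra k E))
    (σ : Equiv.Perm E) (X : Set (E × E)) :
    t.1 (essentialClass k E (permRel E σ * X * permRel E σ⁻¹)) = t.1 (essentialClass k E X) := by
  rw [map_mul, t.2.1, ← map_mul, ← mul_assoc, ← map_mul, inv_mul_cancel, map_one, one_mul]

theorem traceForms_eq_pow {A : Type*} [Ring A] [Algebra k A] (t : traceForms k A) {x : A} {n : ℕ}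
    (hn : 0 < n) (hx : IsIdempotentElem (x ^ n)) : t.1 x = t.1 (x ^ (n + 1)) := by
  rw [← sub_eq_zero, ← map_sub]
  refine t.2.2 _ ⟨n, ?_⟩
  have h : x - x ^ (n + 1) = x * (1 - x ^ n) := by rw [mul_sub, mul_one, pow_succ']
  rw [h, ((Commute.one_right x).sub_right ((Commute.refl x).pow_right n)).mul_pow, hx.one_sub.pow_eq hn.ne',
    mul_sub, mul_one, hx.eq, sub_self]

variable (k)

/-- A finite family of vectors is linearly independent if it is triangular with respect to some
family of linear forms. -/
theorem linearIndependent_of_triangular {ι V : Type*} [Finite ι] [AddCommGroup V] [Module k V]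
    {v : ι → V} (e : ι → V →ₗ[k] k) (w : ι → ℕ) (hne : ∀ i, e i (v i) ≠ 0)
    (hzero : ∀ i j, w j ≤ w i → j ≠ i → e i (v j) = 0) : LinearIndependent k v := by
  have := Fintype.ofFinite ι
  refine Fintype.linearIndependent_iff.2 fun c hc => ?_
  by_contra! h
  obtain ⟨i, hi, hmax⟩ := (Finset.univ.filter fun i => c i ≠ 0).exists_max_image w
    (by simpa [Finset.filter_nonempty_iff] using h)
  have hsum := congrArg (e i) hc
  rw [map_sum, Finset.sum_eq_single i, map_smul, smul_eq_mul, map_zero] at hsum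
  · exact (mul_ne_zero (Finset.mem_filter.1 hi).2 (hne i)) hsum
  · intro j _ hji
    rw [map_smul, smul_eq_mul]
    by_cases hj : c j = 0
    · rw [hj, zero_mul]
    · rw [hzero i j (hmax j (by simpa using hj)) hji, mul_zero]
  · simp

theorem card_le_finrank_traceForms {A ι : Type*} [Ring A] [Algebra k A] [Module.Finite k A]
    [Fintype ι] (t : ι → traceForms k A) (a : ι → A) (w : ι → ℕ) (hne : ∀ i, (t i).1 (a i) ≠ 0)
    (hzero : ∀ i j, w j ≤ w i → j ≠ i → (t j).1 (a i) = 0) :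
    Fintype.card ι ≤ Module.finrank k (traceForms k A) :=
  (linearIndependent_of_triangular k (v := t)
    (fun i => (LinearMap.applyₗ (a i)).comp (Submodule.subtype _)) w hne
    hzero).fintype_card_le_finrank

/-- The trace forms on the essential algebra are counted by the automorphisms of orders up to
conjugacy. -/
theorem finrank_traceForms_essentialAlgebra [CharZero k] {m : ℕ} {Rs : Fin m → Set (E × E)}
    (hRs : ∀ i, IsOrderRel (Rs i))
    (hinj : ∀ i j, (∃ σ : Equiv.Perm E, conjRel σ (Rs i) = Rs j) → i = j)
    (hsurj : ∀ R : Set (E × E), IsOrderRel R →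
      ∃ (i : Fin m) (σ : Equiv.Perm E), conjRel σ (Rs i) = R) :
    Module.finrank k (traceForms k (essentialAlgebra k E)) =
      ∑ i, Nat.card (ConjClasses (autRel E (Rs i))) := by
  rw [← Nat.card_sigma]
  set I := Σ i, ConjClasses (autRel E (Rs i))
  have : Fintype I := Fintype.ofFinite I
  rw [Nat.card_eq_fintype_card]
  choose g hg using fun x : I => ConjClasses.exists_rep x.2
  let r (x : I) : Set (E × E) := Rs x.1 * permRel E (g x).1
  apply le_antisymm
  · let F : traceForms k (essentialAlgebra k E) →ₗ[k] (I → k) :=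
      { toFun := fun t x => t.1 (essentialClass k E (r x))
        map_add' := fun _ _ => rfl
        map_smul' := fun _ _ => rfl }
    suffices hF : Function.Injective F by
      simpa using LinearMap.finrank_le_finrank_of_injective hF
    rw [injective_iff_map_eq_zero]
    intro t ht
    apply Subtype.ext
    refine essentialAlgebra_hom_ext fun X => ?_
    rw [ZeroMemClass.coe_zero, LinearMap.zero_apply]
    obtain ⟨n, hn, hid, hX⟩ := exists_pow_eq_order_mul_perm X
    rw [traceForms_eq_pow t hn (by rw [← map_pow]; exact hid.map _), ← map_pow]
    obtain hX | ⟨hord, σ, hσ, hX⟩ := hX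
    · rw [pow_succ, essentialClass_of_inessential k (hX.mul_right X), map_zero]
    rw [hX]
    obtain ⟨i, π, hπ⟩ := hsurj _ hord
    have hπσ : π⁻¹ * σ * π ∈ autRel E (Rs i) := by
      rw [mem_autRel, conjRel_mul, conjRel_mul, hπ, mem_autRel.1 hσ, ← hπ, ← conjRel_mul,
        inv_mul_cancel, conjRel_one]
    obtain ⟨c, hc⟩ := isConj_iff.1 (ConjClasses.mk_eq_mk_iff_isConj.1
      (hg ⟨i, ConjClasses.mk ⟨_, hπσ⟩⟩))
    have hc : c.1 * (g ⟨i, ConjClasses.mk ⟨_, hπσ⟩⟩).1 * c.1⁻¹ = π⁻¹ * σ * π :=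
      congrArg Subtype.val hc
    rw [← hπ, conjRel_mul_permRel c.2 hc, traceForms_essentialClass_conj]
    exact congrFun ht _
  · refine card_le_finrank_traceForms k (fun x : I => orderForm k (hRs x.1) (g x))
      (fun x => essentialClass k E (r x)) (fun x => (Rs x.1).ncard) (fun x => ?_)
      fun x y hxy hyx => ?_
    · rw [orderForm_essentialClass, Nat.cast_ne_zero, Finset.card_ne_zero]
      exact ⟨1, Finset.mem_filter.2
        ⟨Finset.mem_univ 1, transports_order_mul_permRel_self (hRs x.1) (g x).2⟩⟩
    · rw [orderForm_essentialClass, Nat.cast_eq_zero, Finset.card_eq_zero,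
        Finset.filter_eq_empty_iff]
      intro b _ hb
      obtain ⟨hσ, hsub⟩ := hb.eq_conj_and_subset (hRs x.1) (g y).2
      have heq : Rs x.1 = conjRel b (Rs y.1) := Set.eq_of_subset_of_ncard_le hsub
        (by rw [ncard_conjRel]; exact hxy)
      have hi := hinj y.1 x.1 ⟨b, heq.symm⟩
      obtain ⟨i, x⟩ := x
      obtain ⟨j, y⟩ := y
      obtain rfl : j = i := hi
      refine hyx (Sigma.ext rfl (heq_of_eq ?_))
      have hconj : IsConj (g ⟨j, y⟩) (g ⟨j, x⟩) :=
        isConj_iff.2 ⟨⟨b, heq.symm⟩, Subtype.ext hσ.symm⟩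
      exact (hg ⟨j, y⟩).symm.trans ((ConjClasses.mk_eq_mk_iff_isConj.2 hconj).trans (hg ⟨j, x⟩))

variable (E) in
theorem exists_order_representatives : ∃ (m : ℕ) (Rs : Fin m → Set (E × E)),
    (∀ i, IsOrderRel (Rs i)) ∧
    (∀ i j, (∃ σ : Equiv.Perm E, conjRel σ (Rs i) = Rs j) → i = j) ∧
    ∀ R : Set (E × E), IsOrderRel R → ∃ (i : Fin m) (σ : Equiv.Perm E), conjRel σ (Rs i) = R := by
  let s : Setoid {R : Set (E × E) // IsOrderRel R} :=
    { r := fun R S => ∃ σ : Equiv.Perm E, conjRel σ R.1 = S.1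
      iseqv :=
        { refl := fun R => ⟨1, conjRel_one _⟩
          symm := fun {R S} ⟨σ, h⟩ => ⟨σ⁻¹, by
            rw [← h, ← conjRel_mul, inv_mul_cancel, conjRel_one]⟩
          trans := fun {R S T} ⟨σ, h⟩ ⟨τ, h'⟩ => ⟨τ * σ, by rw [conjRel_mul, h, h']⟩ } }
  obtain ⟨m, ⟨e⟩⟩ := Finite.exists_equiv_fin (Quotient s)
  refine ⟨m, fun i => (e.symm i).out.1, fun i => (e.symm i).out.2, fun i j h => ?_, fun R hR => ?_⟩
  · exact e.symm.injective (Quotient.out_equiv_out.1 h)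
  · refine ⟨e (Quotient.mk s ⟨R, hR⟩), ?_⟩
    simp only [e.symm_apply_apply]
    exact Quotient.mk_out (s := s) ⟨R, hR⟩

end OrderForms

open CategoryTheory in
/-- For an algebraically closed field `k` of characteristic zero and a finite set `E`, the
number `N` of isomorphism classes of simple modules over the essential algebra
`𝓔_E = k𝓒(E,E)/I_E` equals `Σ_{[R]} c(Aut(E,R))`, where `[R]` runs over a set of
representatives of the `Σ_E`-conjugacy classes of partial order relations `R` on `E`,
`Aut(E,R)` is the stabilizer of `R` under the conjugation action of `Σ_E`, and `c(G)`
is the number of conjugacy classes of the finite group `G`. -/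
theorem card_simple_modules_essentialAlgebra (k : Type) [Field k] [IsAlgClosed k]
    [CharZero k] (E : Type) [Fintype E] :
    ∃ (N : ℕ) (M : Fin N → ModuleCat.{0} (essentialAlgebra k E))
      (m : ℕ) (Rs : Fin m → Set (E × E)),
      -- the `M i` form a set of representatives of the isomorphism classes of
      -- simple `𝓔_E`-modules
      (∀ i, IsSimpleModule (essentialAlgebra k E) (M i)) ∧
      (∀ i j, Nonempty (M i ≅ M j) → i = j) ∧
      (∀ V : ModuleCat.{0} (essentialAlgebra k E),
        IsSimpleModule (essentialAlgebra k E) V → ∃ i, Nonempty (V ≅ M i)) ∧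
      -- the `Rs i` form a set of representatives of the `Σ_E`-conjugacy classes of
      -- partial order relations on `E`
      (∀ i, IsOrderRel (Rs i)) ∧
      (∀ i j, (∃ σ : Equiv.Perm E, conjRel σ (Rs i) = Rs j) → i = j) ∧
      (∀ R : Set (E × E), IsOrderRel R →
        ∃ (i : Fin m) (σ : Equiv.Perm E), conjRel σ (Rs i) = R) ∧
      -- the count
      N = ∑ i : Fin m, Nat.card (ConjClasses (autRel E (Rs i))) := by
  obtain ⟨m, Rs, hRs, hinj, hsurj⟩ := exists_order_representatives E
  obtain ⟨M, hM⟩ := exists_simple_modules_finrank_traceForms k (essentialAlgebra k E)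
  exact ⟨_, M, m, Rs, hM.1, hM.2.1, hM.2.2, hRs, hinj, hsurj,
    finrank_traceForms_essentialAlgebra k hRs hinj hsurj⟩
end
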